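/- arXiv:0911.0633 — 3 statements merged into one kernel-verified Lean document; each statement's English description precedes it below -/
import Mathlib

section
/- Let L be a full subcategory of mod(Λ) closed under extensions and direct summands, and let L be an indecomposable module in L such that Ext¹_Λ(L̃, L) ≠ 0 for some L̃ in L. Fix a projective resolution ⋯ → Q₂ → Q₁ →q₁ Q₀ → DL → 0 of the right Λ-module DL by finitely generated projective right Λ-modules, and set TrD L := coker(q₁*: Q₀* → Q₁*), a finitely generated left Λ-module. Then the following are equivalent: (i) there exists N in L and a morphism μ: TrD L → N which is an L-preenvelope of TrD L in the projective stable category; (ii) there exists an Auslander–Reiten sequence 0 → L → B → A → 0 in L. -/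
set_option linter.unusedSectionVars false

open MulOpposite

section DualInstances

variable (k Λ : Type) [Field k] [Ring Λ] [Algebra k Λ]

/-- The left `Λ`-module structure on the `k`-linear dual of a right `Λ`-module `N`,
given by `(a • f) n = f (op a • n)`. -/
instance dualModuleLeft (N : Type) [AddCommGroup N] [Module k N] [Module Λᵐᵒᵖ N]
    [SMulCommClass Λᵐᵒᵖ k N] : Module Λ (N →ₗ[k] k) :=
  { smul := fun a f => f ∘ₗ DistribMulAction.toLinearMap k N (op a)
    one_smul := fun f => LinearMap.ext fun n =>
      show f (op (1 : Λ) • n) = f n by rw [op_one, one_smul]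
    mul_smul := fun a b f => LinearMap.ext fun n =>
      show f (op (a * b) • n) = f (op b • op a • n) by rw [op_mul, mul_smul]
    smul_zero := fun a => LinearMap.ext fun _ => rfl
    smul_add := fun a f g => LinearMap.ext fun _ => rfl
    add_smul := fun a b f => LinearMap.ext fun n =>
      show f (op (a + b) • n) = f (op a • n) + f (op b • n) by
        rw [op_add, add_smul, map_add]
    zero_smul := fun f => LinearMap.ext fun n =>
      show f (op (0 : Λ) • n) = 0 by rw [op_zero, zero_smul, map_zero] }

@[simp] lemma dualModuleLeft_smul_apply (N : Type) [AddCommGroup N] [Module k N]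
    [Module Λᵐᵒᵖ N] [SMulCommClass Λᵐᵒᵖ k N] (a : Λ) (f : N →ₗ[k] k) (n : N) :
    (a • f) n = f (op a • n) := rfl

/-- The right `Λ`-module structure on the `k`-linear dual of a left `Λ`-module `M`,
given by `(x • f) m = f (x.unop • m)`. -/
instance dualModuleRight (M : Type) [AddCommGroup M] [Module k M] [Module Λ M]
    [SMulCommClass Λ k M] : Module Λᵐᵒᵖ (M →ₗ[k] k) :=
  { smul := fun x f => f ∘ₗ DistribMulAction.toLinearMap k M x.unop
    one_smul := fun f => LinearMap.ext fun m =>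
      show f ((1 : Λᵐᵒᵖ).unop • m) = f m by rw [unop_one, one_smul]
    mul_smul := fun x y f => LinearMap.ext fun m =>
      show f ((x * y).unop • m) = f (y.unop • x.unop • m) by rw [unop_mul, mul_smul]
    smul_zero := fun x => LinearMap.ext fun _ => rfl
    smul_add := fun x f g => LinearMap.ext fun _ => rfl
    add_smul := fun x y f => LinearMap.ext fun m =>
      show f ((x + y).unop • m) = f (x.unop • m) + f (y.unop • m) by
        rw [unop_add, add_smul, map_add]
    zero_smul := fun f => LinearMap.ext fun m =>
      show f ((0 : Λᵐᵒᵖ).unop • m) = 0 by rw [unop_zero, zero_smul, map_zero] }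

@[simp] lemma dualModuleRight_smul_apply (M : Type) [AddCommGroup M] [Module k M]
    [Module Λ M] [SMulCommClass Λ k M] (x : Λᵐᵒᵖ) (f : M →ₗ[k] k) (m : M) :
    (x • f) m = f (x.unop • m) := rfl

end DualInstances

section Transpose

variable (k Λ : Type) [Field k] [Ring Λ] [Algebra k Λ]

/-- For a map `p : P' → P` of left `Λ`-modules, the induced map
`p* : Hom_Λ(P, Λ) → Hom_Λ(P', Λ)` of right `Λ`-modules, as a `k`-linear map. -/
def lstar {P' P : Type} [AddCommGroup P'] [Module Λ P'] [AddCommGroup P] [Module Λ P]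
    (p : P' →ₗ[Λ] P) : (P →ₗ[Λ] Λ) →ₗ[k] (P' →ₗ[Λ] Λ) where
  toFun f := f ∘ₗ p
  map_add' f g := by ext x; simp
  map_smul' c f := by ext x; simp

/-- `D(p*) : D(P'*) → D(P*)`, the map induced on `k`-linear duals by `p : P' → P`;
a morphism of left `Λ`-modules. -/
def ldmap {P' P : Type} [AddCommGroup P'] [Module Λ P'] [AddCommGroup P] [Module Λ P]
    (p : P' →ₗ[Λ] P) : ((P' →ₗ[Λ] Λ) →ₗ[k] k) →ₗ[Λ] ((P →ₗ[Λ] Λ) →ₗ[k] k) where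
  toFun φ := φ ∘ₗ lstar k Λ p
  map_add' φ ψ := by ext f; simp
  map_smul' a φ := by
    ext f
    show φ (op a • (f ∘ₗ p)) = φ ((op a • f) ∘ₗ p)
    congr 1

/-- For a map `q : Q' → Q` of right `Λ`-modules, the induced map
`q* : Hom_{Λᵒᵖ}(Q, Λ) → Hom_{Λᵒᵖ}(Q', Λ)` of left `Λ`-modules, as a `k`-linear map. -/
def rstar {Q' Q : Type} [AddCommGroup Q'] [Module Λᵐᵒᵖ Q'] [AddCommGroup Q] [Module Λᵐᵒᵖ Q]
    (q : Q' →ₗ[Λᵐᵒᵖ] Q) : (Q →ₗ[Λᵐᵒᵖ] Λ) →ₗ[k] (Q' →ₗ[Λᵐᵒᵖ] Λ) where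
  toFun f := f ∘ₗ q
  map_add' f g := by ext x; simp
  map_smul' c f := by ext x; simp

/-- The same map `q*`, as a morphism of left `Λ`-modules. -/
def rstarL {Q' Q : Type} [AddCommGroup Q'] [Module Λᵐᵒᵖ Q'] [AddCommGroup Q] [Module Λᵐᵒᵖ Q]
    (q : Q' →ₗ[Λᵐᵒᵖ] Q) : (Q →ₗ[Λᵐᵒᵖ] Λ) →ₗ[Λ] (Q' →ₗ[Λᵐᵒᵖ] Λ) where
  toFun f := f ∘ₗ q
  map_add' f g := by ext x; simp
  map_smul' a f := by ext x; simp

/-- `D(q*) : D(Q'*) → D(Q*)`, a morphism of right `Λ`-modules. -/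
def rdmap {Q' Q : Type} [AddCommGroup Q'] [Module Λᵐᵒᵖ Q'] [AddCommGroup Q] [Module Λᵐᵒᵖ Q]
    (q : Q' →ₗ[Λᵐᵒᵖ] Q) : ((Q' →ₗ[Λᵐᵒᵖ] Λ) →ₗ[k] k) →ₗ[Λᵐᵒᵖ] ((Q →ₗ[Λᵐᵒᵖ] Λ) →ₗ[k] k) where
  toFun φ := φ ∘ₗ rstar k Λ q
  map_add' φ ψ := by ext f; simp
  map_smul' x φ := by
    ext f
    show φ (x.unop • (f ∘ₗ q)) = φ ((x.unop • f) ∘ₗ q)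
    congr 1

end Transpose
section Subcategories

variable (R : Type) [Ring R]

/-- `f : A → B` factors through an injective `R`-module. -/
def FactorsThroughInjective {A B : Type} [AddCommGroup A] [Module R A]
    [AddCommGroup B] [Module R B] (f : A →ₗ[R] B) : Prop :=
  ∃ (U : ModuleCat.{0} R), Module.Injective R ↥U ∧
    ∃ (g : A →ₗ[R] ↥U) (h : ↥U →ₗ[R] B), h ∘ₗ g = f

/-- `f : A → B` factors through a projective `R`-module. -/
def FactorsThroughProjective {A B : Type} [AddCommGroup A] [Module R A]
    [AddCommGroup B] [Module R B] (f : A →ₗ[R] B) : Prop :=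
  ∃ (U : ModuleCat.{0} R), Module.Projective R ↥U ∧
    ∃ (g : A →ₗ[R] ↥U) (h : ↥U →ₗ[R] B), h ∘ₗ g = f

/-- A module is indecomposable if it is nonzero and its endomorphism ring has no
nontrivial idempotents. -/
def IsIndecomposable (M : Type) [AddCommGroup M] [Module R M] : Prop :=
  Nontrivial M ∧ ∀ f : M →ₗ[R] M, f ∘ₗ f = f → f = 0 ∨ f = LinearMap.id

/-- `Ext¹(C, A) ≠ 0`: there is a non-split short exact sequence `0 → A → E → C → 0`. -/
def HasNonSplitExtension (C A : Type) [AddCommGroup C] [Module R C]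
    [AddCommGroup A] [Module R A] : Prop :=
  ∃ (E : ModuleCat.{0} R) (ι : A →ₗ[R] ↥E) (π : ↥E →ₗ[R] C),
    Function.Injective ι ∧ Function.Surjective π ∧ Function.Exact ι π ∧
    ¬ ∃ s : C →ₗ[R] ↥E, π ∘ₗ s = LinearMap.id

/-- The subcategory `𝓝` of `mod R` is closed under isomorphisms. -/
def ClosedUnderIso (𝓝 : Set (ModuleCat.{0} R)) : Prop :=
  ∀ X Y : ModuleCat.{0} R, (↥X ≃ₗ[R] ↥Y) → X ∈ 𝓝 → Y ∈ 𝓝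

/-- The subcategory `𝓝` of `mod R` is closed under extensions. -/
def ClosedUnderExtensions (𝓝 : Set (ModuleCat.{0} R)) : Prop :=
  ∀ (A B C : ModuleCat.{0} R) (f : ↥A →ₗ[R] ↥B) (g : ↥B →ₗ[R] ↥C),
    Function.Injective f → Function.Surjective g → Function.Exact f g →
    A ∈ 𝓝 → C ∈ 𝓝 → B ∈ 𝓝

/-- The subcategory `𝓝` of `mod R` is closed under direct summands. -/
def ClosedUnderSummands (𝓝 : Set (ModuleCat.{0} R)) : Prop :=
  ∀ (X Y : ModuleCat.{0} R) (i : ↥X →ₗ[R] ↥Y) (p : ↥Y →ₗ[R] ↥X),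
    p ∘ₗ i = LinearMap.id → Y ∈ 𝓝 → X ∈ 𝓝

/-- `g : Y → Z` is right almost split in the subcategory `𝓝`. -/
def IsRightAlmostSplit (𝓝 : Set (ModuleCat.{0} R)) {Y Z : Type}
    [AddCommGroup Y] [Module R Y] [AddCommGroup Z] [Module R Z] (g : Y →ₗ[R] Z) : Prop :=
  (¬ ∃ s : Z →ₗ[R] Y, g ∘ₗ s = LinearMap.id) ∧
  ∀ (Z' : ModuleCat.{0} R), Z' ∈ 𝓝 → ∀ h : ↥Z' →ₗ[R] Z,
    (¬ ∃ s : Z →ₗ[R] ↥Z', h ∘ₗ s = LinearMap.id) → ∃ h' : ↥Z' →ₗ[R] Y, g ∘ₗ h' = h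

/-- `f : X → Y` is left almost split in the subcategory `𝓝`. -/
def IsLeftAlmostSplit (𝓝 : Set (ModuleCat.{0} R)) {X Y : Type}
    [AddCommGroup X] [Module R X] [AddCommGroup Y] [Module R Y] (f : X →ₗ[R] Y) : Prop :=
  (¬ ∃ r : Y →ₗ[R] X, r ∘ₗ f = LinearMap.id) ∧
  ∀ (X' : ModuleCat.{0} R), X' ∈ 𝓝 → ∀ h : X →ₗ[R] ↥X',
    (¬ ∃ r : ↥X' →ₗ[R] X, r ∘ₗ h = LinearMap.id) → ∃ h' : Y →ₗ[R] ↥X', h' ∘ₗ f = h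

/-- `0 → X →f Y →g Z → 0` is an Auslander-Reiten sequence in the subcategory `𝓝`. -/
def IsAuslanderReitenSequence (𝓝 : Set (ModuleCat.{0} R)) {X Y Z : Type}
    [AddCommGroup X] [Module R X] [AddCommGroup Y] [Module R Y] [AddCommGroup Z] [Module R Z]
    (f : X →ₗ[R] Y) (g : Y →ₗ[R] Z) : Prop :=
  ModuleCat.of R X ∈ 𝓝 ∧ ModuleCat.of R Y ∈ 𝓝 ∧ ModuleCat.of R Z ∈ 𝓝 ∧
  Function.Injective f ∧ Function.Surjective g ∧ Function.Exact f g ∧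
  IsLeftAlmostSplit R 𝓝 f ∧ IsRightAlmostSplit R 𝓝 g

end Subcategories

section Helpers
variable {k Λ : Type} [Field k] [Ring Λ] [Algebra k Λ]

/-- The map `f ↦ f u • x`. -/
def evMap {Q X : Type} [AddCommGroup Q] [Module Λᵐᵒᵖ Q] [AddCommGroup X] [Module Λ X]
    (u : Q) (x : X) : (Q →ₗ[Λᵐᵒᵖ] Λ) →ₗ[Λ] X where
  toFun f := f u • x
  map_add' f g := by simp [add_smul]
  map_smul' a f := by simp [mul_smul]

@[simp] lemma evMap_apply {Q X : Type} [AddCommGroup Q] [Module Λᵐᵒᵖ Q] [AddCommGroup X] [Module Λ X]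
    (u : Q) (x : X) (f : Q →ₗ[Λᵐᵒᵖ] Λ) : evMap u x f = f u • x := rfl

lemma exists_dual_basis (Q : Type) [AddCommGroup Q] [Module Λᵐᵒᵖ Q]
    [Module.Finite Λᵐᵒᵖ Q] [Module.Projective Λᵐᵒᵖ Q] :
    ∃ (n : ℕ) (u : Fin n → Q) (f : Fin n → (Q →ₗ[Λᵐᵒᵖ] Λ)),
      ∀ x : Q, ∑ i, op (f i x) • u i = x := by
  obtain ⟨n, f, g, -, -, h⟩ := Module.Finite.exists_comp_eq_id_of_projective Λᵐᵒᵖ Q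
  refine ⟨n, fun i => f (Pi.single i 1), fun i =>
    { toFun := fun x => unop (g x i)
      map_add' := by simp
      map_smul' := by intro a x; simp }, fun x => ?_⟩
  have h1 : f (g x) = x := LinearMap.congr_fun h x
  conv_rhs => rw [← h1, ← (Pi.basisFun Λᵐᵒᵖ (Fin n)).sum_repr (g x), map_sum]
  simp

lemma expand_ev {Q X : Type} [AddCommGroup Q] [Module Λᵐᵒᵖ Q] [AddCommGroup X] [Module Λ X]
    {n : ℕ} {u : Fin n → Q} {f : Fin n → (Q →ₗ[Λᵐᵒᵖ] Λ)}
    (h : ∀ x : Q, ∑ i, op (f i x) • u i = x) (F : (Q →ₗ[Λᵐᵒᵖ] Λ) →ₗ[Λ] X) :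
    F = ∑ i, evMap (u i) (F (f i)) := by
  ext g
  have : g = ∑ i, g (u i) • f i := by
    ext x
    conv_lhs => rw [← h x]
    simp
  conv_lhs => rw [this]
  simp

section
variable {Q X : Type} [AddCommGroup Q] [Module Λᵐᵒᵖ Q] [AddCommGroup X] [Module Λ X]
  [Module k Q] [IsScalarTower k Λᵐᵒᵖ Q] [SMulCommClass Λᵐᵒᵖ k Q]
  [Module k X] [IsScalarTower k Λ X] [SMulCommClass Λ k X]

lemma dual_smul_algebraMap (c : k) (φ : Q →ₗ[k] k) : (algebraMap k Λ c) • φ = c • φ := by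
  ext u
  have : op (algebraMap k Λ c) • u = c • u := by
    rw [← algebraMap_smul Λᵐᵒᵖ c u]; rfl
  simp [this]

/-- Functionals on `Hom(Q*, X)` give maps `X → DQ`. -/
def curryEv (Φ : ((Q →ₗ[Λᵐᵒᵖ] Λ) →ₗ[Λ] X) →ₗ[k] k) : X →ₗ[Λ] (Q →ₗ[k] k) where
  toFun x :=
    { toFun := fun u => Φ (evMap u x)
      map_add' := fun u v => by
        rw [← map_add]; congr 1; ext f; simp [add_smul]
      map_smul' := fun c u => by
        rw [RingHom.id_apply, ← map_smul]; congr 1; ext f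
        have : f (c • u) = algebraMap k Λ c * f u := by
          rw [← algebraMap_smul Λᵐᵒᵖ c u, map_smul]
          exact (Algebra.commutes c (f u)).symm
        simp [this, mul_smul] }
  map_add' x y := by
    ext u
    show Φ _ = Φ _ + Φ _
    rw [← map_add]; congr 1; ext f; simp
  map_smul' a x := by
    ext u
    show Φ (evMap u (a • x)) = Φ (evMap (op a • u) x)
    congr 1; ext f; simp [mul_smul]

lemma curryEv_apply (Φ : ((Q →ₗ[Λᵐᵒᵖ] Λ) →ₗ[Λ] X) →ₗ[k] k) (x : X) (u : Q) :
    curryEv Φ x u = Φ (evMap u x) := rfl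

lemma exists_uncurry [Module.Finite Λᵐᵒᵖ Q] [Module.Projective Λᵐᵒᵖ Q]
    (α : X →ₗ[Λ] (Q →ₗ[k] k)) :
    ∃ Φ : ((Q →ₗ[Λᵐᵒᵖ] Λ) →ₗ[Λ] X) →ₗ[k] k, ∀ x u, Φ (evMap u x) = α x u := by
  obtain ⟨n, b, f, h⟩ := exists_dual_basis (Λ := Λ) Q
  refine ⟨{ toFun := fun F => ∑ i, α (F (f i)) (b i)
            map_add' := fun F G => by simp [Finset.sum_add_distrib]
            map_smul' := fun c F => ?_ }, fun x u => ?_⟩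
  · simp only [LinearMap.smul_apply, RingHom.id_apply, smul_eq_mul, Finset.mul_sum]
    refine Finset.sum_congr rfl fun i _ => ?_
    rw [← algebraMap_smul Λ c (F (f i)), map_smul, dual_smul_algebraMap]
    simp
  · show ∑ i, α (evMap u x (f i)) (b i) = _
    conv_rhs => rw [← h u]
    simp

lemma functional_ext [Module.Finite Λᵐᵒᵖ Q] [Module.Projective Λᵐᵒᵖ Q]
    {Φ Ψ : ((Q →ₗ[Λᵐᵒᵖ] Λ) →ₗ[Λ] X) →ₗ[k] k}
    (h : ∀ (x : X) (u : Q), Φ (evMap u x) = Ψ (evMap u x)) : Φ = Ψ := by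
  obtain ⟨n, b, f, hb⟩ := exists_dual_basis (Λ := Λ) Q
  ext F
  rw [expand_ev hb F]
  simp [h]
end

lemma dual_extend {V W : Type} [AddCommGroup V] [Module k V] [AddCommGroup W] [Module k W]
    (p : V →ₗ[k] W) (Φ : V →ₗ[k] k) (h : ∀ v, p v = 0 → Φ v = 0) :
    ∃ Ψ : W →ₗ[k] k, ∀ v, Ψ (p v) = Φ v := by
  have : Φ ∈ LinearMap.range p.dualMap := by
    rw [LinearMap.range_dualMap_eq_dualAnnihilator_ker, Submodule.mem_dualAnnihilator]
    exact fun w hw => h w hw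
  obtain ⟨Ψ, rfl⟩ := this
  exact ⟨Ψ, fun v => rfl⟩

/-- precomposition, `k`-linear. -/
def precompK {M N X : Type} [AddCommGroup M] [Module Λ M] [AddCommGroup N] [Module Λ N]
    [AddCommGroup X] [Module Λ X] [Module k X] [SMulCommClass Λ k X] (p : M →ₗ[Λ] N) :
    (N →ₗ[Λ] X) →ₗ[k] (M →ₗ[Λ] X) where
  toFun F := F ∘ₗ p
  map_add' _ _ := rfl
  map_smul' _ _ := rfl

lemma precompK_apply {M N X : Type} [AddCommGroup M] [Module Λ M] [AddCommGroup N] [Module Λ N]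
    [AddCommGroup X] [Module Λ X] [Module k X] [SMulCommClass Λ k X] (p : M →ₗ[Λ] N)
    (F : N →ₗ[Λ] X) : precompK (k := k) p F = F ∘ₗ p := rfl

lemma lin_algebraMap {X A : Type} [AddCommGroup X] [Module Λ X] [Module k X] [IsScalarTower k Λ X]
    [AddCommGroup A] [Module Λ A] [Module k A] [IsScalarTower k Λ A]
    (h : X →ₗ[Λ] A) (c : k) (x : X) : h (c • x) = c • h x := by
  rw [← algebraMap_smul Λ c x, map_smul, algebraMap_smul]

/-- postcomposition, `k`-linear. -/
def postcompK {M X A : Type} [AddCommGroup M] [Module Λ M] [AddCommGroup A] [Module Λ A]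
    [AddCommGroup X] [Module Λ X] [Module k X] [SMulCommClass Λ k X] [IsScalarTower k Λ X]
    [Module k A] [SMulCommClass Λ k A] [IsScalarTower k Λ A] (h : X →ₗ[Λ] A) :
    (M →ₗ[Λ] X) →ₗ[k] (M →ₗ[Λ] A) where
  toFun F := h ∘ₗ F
  map_add' F G := by ext; simp
  map_smul' c F := by ext; simp

lemma postcompK_apply {M X A : Type} [AddCommGroup M] [Module Λ M] [AddCommGroup A] [Module Λ A]
    [AddCommGroup X] [Module Λ X] [Module k X] [SMulCommClass Λ k X] [IsScalarTower k Λ X]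
    [Module k A] [SMulCommClass Λ k A] [IsScalarTower k Λ A] (h : X →ₗ[Λ] A)
    (F : M →ₗ[Λ] X) : postcompK (k := k) h F = h ∘ₗ F := rfl

/-- Key lemma. -/
lemma key_lift {Q0 Q1 X : Type} [AddCommGroup Q0] [Module Λᵐᵒᵖ Q0] [AddCommGroup Q1]
    [Module Λᵐᵒᵖ Q1] [AddCommGroup X] [Module Λ X]
    [Module k Q0] [IsScalarTower k Λᵐᵒᵖ Q0] [SMulCommClass Λᵐᵒᵖ k Q0]
    [Module k Q1] [IsScalarTower k Λᵐᵒᵖ Q1] [SMulCommClass Λᵐᵒᵖ k Q1]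
    [Module k X] [IsScalarTower k Λ X] [SMulCommClass Λ k X]
    [Module.Finite Λᵐᵒᵖ Q0] [Module.Projective Λᵐᵒᵖ Q0]
    [Module.Finite Λᵐᵒᵖ Q1] [Module.Projective Λᵐᵒᵖ Q1]
    (q : Q1 →ₗ[Λᵐᵒᵖ] Q0) (Φ : ((Q1 →ₗ[Λᵐᵒᵖ] Λ) →ₗ[Λ] X) →ₗ[k] k) :
    (∃ β : X →ₗ[Λ] (Q0 →ₗ[k] k), ∀ x u, β x (q u) = Φ (evMap u x)) ↔
      ∀ F : (Q1 →ₗ[Λᵐᵒᵖ] Λ) →ₗ[Λ] X, F ∘ₗ rstarL Λ q = 0 → Φ F = 0 := by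
  constructor
  · rintro ⟨β, hβ⟩ F hF
    obtain ⟨Ψ, hΨ⟩ := exists_uncurry β
    have : Φ = Ψ ∘ₗ precompK (rstarL Λ q) := by
      apply functional_ext
      intro x u
      rw [← hβ, ← hΨ]
      rfl
    rw [this, LinearMap.comp_apply, precompK_apply, hF, map_zero]
  · intro h
    obtain ⟨Ψ, hΨ⟩ := dual_extend (precompK (rstarL Λ q)) Φ h
    refine ⟨curryEv Ψ, fun x u => ?_⟩
    rw [curryEv_apply, ← hΨ]
    rfl

lemma qk_smul {Q0 Q1 : Type} [AddCommGroup Q0] [Module Λᵐᵒᵖ Q0] [AddCommGroup Q1]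
    [Module Λᵐᵒᵖ Q1] [Module k Q0] [IsScalarTower k Λᵐᵒᵖ Q0]
    [Module k Q1] [IsScalarTower k Λᵐᵒᵖ Q1] (q : Q1 →ₗ[Λᵐᵒᵖ] Q0) (c : k) (u : Q1) :
    q (c • u) = c • q u := by
  rw [← algebraMap_smul Λᵐᵒᵖ c u, map_smul, algebraMap_smul]

/-- The map `DQ0 → DQ1` induced by `q`. -/
def dmap {Q0 Q1 : Type} [AddCommGroup Q0] [Module Λᵐᵒᵖ Q0] [AddCommGroup Q1]
    [Module Λᵐᵒᵖ Q1] [Module k Q0] [IsScalarTower k Λᵐᵒᵖ Q0] [SMulCommClass Λᵐᵒᵖ k Q0]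
    [Module k Q1] [IsScalarTower k Λᵐᵒᵖ Q1] [SMulCommClass Λᵐᵒᵖ k Q1]
    (q : Q1 →ₗ[Λᵐᵒᵖ] Q0) : (Q0 →ₗ[k] k) →ₗ[Λ] (Q1 →ₗ[k] k) where
  toFun φ :=
    { toFun := fun u => φ (q u)
      map_add' := fun u v => by simp
      map_smul' := fun c u => by rw [qk_smul]; simp }
  map_add' φ ψ := by ext; simp
  map_smul' a φ := by
    ext u
    show φ (op a • q u) = φ (q (op a • u))
    rw [map_smul q]

lemma dmap_apply {Q0 Q1 : Type} [AddCommGroup Q0] [Module Λᵐᵒᵖ Q0] [AddCommGroup Q1]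
    [Module Λᵐᵒᵖ Q1] [Module k Q0] [IsScalarTower k Λᵐᵒᵖ Q0] [SMulCommClass Λᵐᵒᵖ k Q0]
    [Module k Q1] [IsScalarTower k Λᵐᵒᵖ Q1] [SMulCommClass Λᵐᵒᵖ k Q1]
    (q : Q1 →ₗ[Λᵐᵒᵖ] Q0) (φ : Q0 →ₗ[k] k) (u : Q1) : dmap q φ u = φ (q u) := rfl

section
variable {L Q0 Q1 Q2 : Type} [AddCommGroup L] [Module k L] [Module Λ L] [IsScalarTower k Λ L]
    [SMulCommClass Λ k L]
    [AddCommGroup Q0] [Module Λᵐᵒᵖ Q0]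
    [Module k Q0] [IsScalarTower k Λᵐᵒᵖ Q0] [SMulCommClass Λᵐᵒᵖ k Q0]
    [AddCommGroup Q1] [Module Λᵐᵒᵖ Q1]
    [Module k Q1] [IsScalarTower k Λᵐᵒᵖ Q1] [SMulCommClass Λᵐᵒᵖ k Q1]
    [AddCommGroup Q2] [Module Λᵐᵒᵖ Q2]

lemma eps_smul (ε : Q0 →ₗ[Λᵐᵒᵖ] (L →ₗ[k] k)) (c : k) (u : Q0) : ε (c • u) = c • ε u := by
  rw [← algebraMap_smul Λᵐᵒᵖ c u, map_smul]
  ext l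
  have : (algebraMap k Λᵐᵒᵖ c).unop • l = c • l := algebraMap_smul Λ c l
  simp [this]

/-- The map `L → DQ0` induced by `ε`. -/
def jmap (ε : Q0 →ₗ[Λᵐᵒᵖ] (L →ₗ[k] k)) : L →ₗ[Λ] (Q0 →ₗ[k] k) where
  toFun l :=
    { toFun := fun u => ε u l
      map_add' := fun u v => by simp
      map_smul' := fun c u => by rw [eps_smul]; simp }
  map_add' φ ψ := by ext; simp
  map_smul' a φ := by
    ext u
    show ε u (a • φ) = ε (op a • u) φ
    rw [map_smul ε]; rfl

lemma jmap_apply (ε : Q0 →ₗ[Λᵐᵒᵖ] (L →ₗ[k] k)) (l : L) (u : Q0) : jmap ε l u = ε u l := rfl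

lemma jmap_injective (ε : Q0 →ₗ[Λᵐᵒᵖ] (L →ₗ[k] k)) (hε : Function.Surjective ε) :
    Function.Injective (jmap ε) := by
  rw [injective_iff_map_eq_zero]
  intro l hl
  rw [← Module.forall_dual_apply_eq_zero_iff k l]
  intro φ
  obtain ⟨u, rfl⟩ := hε φ
  exact LinearMap.congr_fun hl u

lemma dmap_jmap (q : Q1 →ₗ[Λᵐᵒᵖ] Q0) (ε : Q0 →ₗ[Λᵐᵒᵖ] (L →ₗ[k] k))
    (hex0 : Function.Exact q ε) (l : L) : dmap q (jmap ε l) = 0 := by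
  ext u
  rw [dmap_apply, jmap_apply, hex0.apply_apply_eq_zero]; rfl

lemma exact_jmap [FiniteDimensional k L] (q : Q1 →ₗ[Λᵐᵒᵖ] Q0) (ε : Q0 →ₗ[Λᵐᵒᵖ] (L →ₗ[k] k))
    (hε : Function.Surjective ε) (hex0 : Function.Exact q ε) (φ : Q0 →ₗ[k] k)
    (h : dmap q φ = 0) : ∃ l, jmap ε l = φ := by
  let ε' : Q0 →ₗ[k] (L →ₗ[k] k) := { toFun := ε, map_add' := map_add ε, map_smul' := eps_smul ε }
  obtain ⟨Ψ, hΨ⟩ := dual_extend ε' φ (by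
    intro v hv
    obtain ⟨u, rfl⟩ := (hex0 v).1 hv
    exact LinearMap.congr_fun h u)
  obtain ⟨l, hl⟩ := (Module.evalEquiv k L).surjective Ψ
  refine ⟨l, ?_⟩
  ext u
  rw [← hΨ, ← hl]
  rfl

lemma exact_dmap (q0 : Q1 →ₗ[Λᵐᵒᵖ] Q0) (q1 : Q2 →ₗ[Λᵐᵒᵖ] Q1)
    (hex : Function.Exact q1 q0) (φ : Q1 →ₗ[k] k)
    (h : ∀ v, φ (q1 v) = 0) : ∃ ψ, dmap q0 ψ = φ := by
  let q' : Q1 →ₗ[k] Q0 := { toFun := q0, map_add' := map_add q0, map_smul' := qk_smul q0 }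
  obtain ⟨Ψ, hΨ⟩ := dual_extend q' φ (by
    intro v hv
    obtain ⟨u, rfl⟩ := (hex v).1 hv
    exact h u)
  exact ⟨Ψ, LinearMap.ext hΨ⟩

variable [Module.Finite Λᵐᵒᵖ Q0] [Module.Projective Λᵐᵒᵖ Q0]
    [Module.Finite Λᵐᵒᵖ Q1] [Module.Projective Λᵐᵒᵖ Q1]

/-- Functionals on the stable Hom give extensions. -/
lemma extension_of_functional [FiniteDimensional k L]
    (q0 : Q1 →ₗ[Λᵐᵒᵖ] Q0) (q1 : Q2 →ₗ[Λᵐᵒᵖ] Q1) (ε : Q0 →ₗ[Λᵐᵒᵖ] (L →ₗ[k] k))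
    (hε : Function.Surjective ε) (hex0 : Function.Exact q0 ε) (hex : Function.Exact q1 q0)
    {A : Type} [AddCommGroup A] [Module Λ A] [Module k A] [IsScalarTower k Λ A]
    [SMulCommClass Λ k A]
    (φ : (((Q1 →ₗ[Λᵐᵒᵖ] Λ) ⧸ LinearMap.range (rstarL Λ q0)) →ₗ[Λ] A) →ₗ[k] k)
    (hφ : ∀ t, FactorsThroughProjective Λ t → φ t = 0) :
    ∃ (E : ModuleCat.{0} Λ) (ι : L →ₗ[Λ] E) (π : E →ₗ[Λ] A),
      Function.Injective ι ∧ Function.Surjective π ∧ Function.Exact ι π ∧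
      ∀ (X : ModuleCat.{0} Λ) (h : X →ₗ[Λ] A), (∃ h' : X →ₗ[Λ] E, π ∘ₗ h' = h) ↔
        ∀ t : ((Q1 →ₗ[Λᵐᵒᵖ] Λ) ⧸ LinearMap.range (rstarL Λ q0)) →ₗ[Λ] X, φ (h ∘ₗ t) = 0 := by
  obtain ⟨Φ, hΦ⟩ := dual_extend (precompK (LinearMap.range (rstarL Λ q0)).mkQ) φ (by
    intro t ht
    have : t = 0 := by
      apply Submodule.linearMap_qext
      rw [precompK_apply] at ht
      rw [ht]; rfl
    rw [this, map_zero])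
  have hcyc : ∀ (a : A) (v : Q2), curryEv Φ a (q1 v) = 0 := by
    intro a v
    rw [curryEv_apply]
    let s : ((Q1 →ₗ[Λᵐᵒᵖ] Λ) ⧸ LinearMap.range (rstarL Λ q0)) →ₗ[Λ] Λ :=
      (LinearMap.range (rstarL Λ q0)).liftQ (evMap (q1 v) (1 : Λ)) (by
        rintro _ ⟨g, rfl⟩
        show g (q0 (q1 v)) • (1 : Λ) = 0
        rw [hex.apply_apply_eq_zero, map_zero, zero_smul])
    have : evMap (q1 v) a = precompK (k := k) (LinearMap.range (rstarL Λ q0)).mkQ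
        (LinearMap.toSpanSingleton Λ A a ∘ₗ s) := by
      ext f
      simp [precompK_apply, s]
    rw [this, hΦ]
    exact hφ _ ⟨ModuleCat.of Λ Λ, (inferInstance : Module.Projective Λ Λ), s,
      LinearMap.toSpanSingleton Λ A a, rfl⟩
  let S : Submodule Λ ((Q0 →ₗ[k] k) × A) :=
    LinearMap.eqLocus (dmap q0 ∘ₗ LinearMap.fst Λ _ _) (curryEv Φ ∘ₗ LinearMap.snd Λ _ _)
  have hS : ∀ d a, (d, a) ∈ S ↔ dmap q0 d = curryEv Φ a := fun d a => Iff.rfl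
  refine ⟨ModuleCat.of Λ S, LinearMap.codRestrict S (LinearMap.inl Λ _ _ ∘ₗ jmap ε) ?_,
    LinearMap.snd Λ _ _ ∘ₗ S.subtype, ?_, ?_, ?_, ?_⟩
  · intro l
    show (jmap ε l, (0 : A)) ∈ S
    rw [hS, dmap_jmap _ _ hex0, map_zero]
  · intro l l' h
    have := congrArg (fun z : S => z.1.1) h
    exact jmap_injective ε hε this
  · intro a
    obtain ⟨ψ, hψ⟩ := exact_dmap q0 q1 hex (curryEv Φ a) (hcyc a)
    exact ⟨⟨(ψ, a), (hS _ _).2 hψ⟩, rfl⟩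
  · rintro ⟨⟨d, a⟩, hd⟩
    constructor
    · intro h
      have h' : a = 0 := h
      subst h'
      rw [hS, map_zero] at hd
      obtain ⟨l, rfl⟩ := exact_jmap q0 ε hε hex0 d hd
      exact ⟨l, rfl⟩
    · rintro ⟨l, hl⟩
      have := congrArg (fun z : S => z.1.2) hl
      exact this.symm
  · intro X h
    let _ : Module k X := Module.compHom X (algebraMap k Λ)
    have _ : IsScalarTower k Λ X := IsScalarTower.of_compHom k Λ X
    have _ : SMulCommClass Λ k X := IsScalarTower.to_smulCommClass'
    have key := key_lift q0 (Φ ∘ₗ postcompK h)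
    have e1 : (∃ h' : X →ₗ[Λ] S, (LinearMap.snd Λ _ _ ∘ₗ S.subtype) ∘ₗ h' = h) ↔
        (∃ β : X →ₗ[Λ] (Q0 →ₗ[k] k), ∀ x u, β x (q0 u) = (Φ ∘ₗ postcompK h) (evMap u x)) := by
      have e2 : ∀ x u, (Φ ∘ₗ postcompK h) (evMap u x) = curryEv Φ (h x) u := by
        intro x u
        rw [curryEv_apply, LinearMap.comp_apply, postcompK_apply]
        congr 1
        ext f; simp
      constructor
      · rintro ⟨h', rfl⟩
        refine ⟨(LinearMap.fst Λ _ _ ∘ₗ S.subtype) ∘ₗ h', fun x u => ?_⟩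
        rw [e2]
        exact LinearMap.congr_fun (h' x).2 u
      · rintro ⟨β, hβ⟩
        refine ⟨LinearMap.codRestrict S (LinearMap.prod β h) fun x => ?_, rfl⟩
        show (β x, h x) ∈ S
        rw [hS]
        ext u
        rw [dmap_apply, hβ, e2]
    refine e1.trans (key.trans ?_)
    constructor
    · intro H t
      rw [← hΦ]
      refine H (t ∘ₗ (LinearMap.range (rstarL Λ q0)).mkQ) ?_
      ext g
      have : (LinearMap.range (rstarL Λ q0)).mkQ (rstarL Λ q0 g) = 0 := by simp
      show t _ = 0
      rw [this, map_zero]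
    · intro H F hF
      have := H ((LinearMap.range (rstarL Λ q0)).liftQ F (by
        rintro _ ⟨g, rfl⟩
        exact LinearMap.congr_fun hF g))
      rw [← hΦ] at this
      rw [← this]
      show Φ _ = Φ _
      congr 1

/-- Vanishing of stable Hom gives splitting of extensions. -/
lemma split_of_stable_zero [FiniteDimensional k L]
    (q0 : Q1 →ₗ[Λᵐᵒᵖ] Q0) (q1 : Q2 →ₗ[Λᵐᵒᵖ] Q1) (ε : Q0 →ₗ[Λᵐᵒᵖ] (L →ₗ[k] k))
    (hε : Function.Surjective ε) (hex0 : Function.Exact q0 ε) (hex : Function.Exact q1 q0)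
    {X : Type} [AddCommGroup X] [Module Λ X]
    (hX : ∀ t : ((Q1 →ₗ[Λᵐᵒᵖ] Λ) ⧸ LinearMap.range (rstarL Λ q0)) →ₗ[Λ] X,
      FactorsThroughProjective Λ t)
    {E : Type} [AddCommGroup E] [Module Λ E] (ι : L →ₗ[Λ] E) (π : E →ₗ[Λ] X)
    (hι : Function.Injective ι) (hπ : Function.Surjective π) (he : Function.Exact ι π) :
    ∃ s : X →ₗ[Λ] E, π ∘ₗ s = LinearMap.id := by
  let _ : Module k X := Module.compHom X (algebraMap k Λ)
  have _ : IsScalarTower k Λ X := IsScalarTower.of_compHom k Λ X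
  have _ : SMulCommClass Λ k X := IsScalarTower.to_smulCommClass'
  let _ : Module k E := Module.compHom E (algebraMap k Λ)
  have _ : IsScalarTower k Λ E := IsScalarTower.of_compHom k Λ E
  have _ : SMulCommClass Λ k E := IsScalarTower.to_smulCommClass'
  -- extend `j` to `E`
  obtain ⟨J, hJ⟩ := exists_uncurry (jmap ε)
  obtain ⟨Ψ, hΨ⟩ := dual_extend (postcompK ι) J (by
    intro F hF
    have : F = 0 := by
      ext f
      apply hι
      rw [LinearMap.zero_apply, map_zero]
      exact LinearMap.congr_fun hF f
    rw [this, map_zero])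
  have hγ : ∀ l, curryEv Ψ (ι l) = jmap ε l := by
    intro l
    ext u
    rw [curryEv_apply, ← hJ, ← hΨ, postcompK_apply]
    congr 1; ext f; simp
  set γ : E →ₗ[Λ] (Q0 →ₗ[k] k) := curryEv Ψ with hγdef
  -- the induced map `X → DQ1`
  have hker : LinearMap.ker π ≤ LinearMap.ker (dmap q0 ∘ₗ γ) := by
    intro e hes
    obtain ⟨l, rfl⟩ := (he e).1 hes
    rw [LinearMap.mem_ker, LinearMap.comp_apply, hγ, dmap_jmap _ _ hex0]
  let α : X →ₗ[Λ] (Q1 →ₗ[k] k) :=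
    (LinearMap.ker π).liftQ (dmap q0 ∘ₗ γ) hker ∘ₗ
      (π.quotKerEquivOfSurjective hπ).symm.toLinearMap
  have hα : ∀ e, α (π e) = dmap q0 (γ e) := by
    intro e
    have : (π.quotKerEquivOfSurjective hπ).symm (π e) = (LinearMap.ker π).mkQ e := by
      rw [LinearEquiv.symm_apply_eq]; rfl
    show (LinearMap.ker π).liftQ (dmap q0 ∘ₗ γ) hker ((π.quotKerEquivOfSurjective hπ).symm (π e)) = _
    rw [this]; rfl
  obtain ⟨Φ, hΦ⟩ := exists_uncurry α
  obtain ⟨β, hβ⟩ := (key_lift q0 Φ).2 (by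
    intro F hF
    let t : ((Q1 →ₗ[Λᵐᵒᵖ] Λ) ⧸ LinearMap.range (rstarL Λ q0)) →ₗ[Λ] X :=
      (LinearMap.range (rstarL Λ q0)).liftQ F (by
        rintro _ ⟨g, rfl⟩
        exact LinearMap.congr_fun hF g)
    obtain ⟨U, hU, g, h, hgh⟩ := hX t
    let _ : Module k U := Module.compHom U (algebraMap k Λ)
    have _ : IsScalarTower k Λ U := IsScalarTower.of_compHom k Λ U
    have _ : SMulCommClass Λ k U := IsScalarTower.to_smulCommClass'
    obtain ⟨h', hh'⟩ := Module.projective_lifting_property π h hπ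
    have := (key_lift q0 (Φ ∘ₗ postcompK h)).1 ⟨γ ∘ₗ h', by
      intro x u
      have e2 : (Φ ∘ₗ postcompK h) (evMap u x) = α (h x) u := by
        rw [← hΦ, LinearMap.comp_apply, postcompK_apply]
        congr 1
        ext f; simp
      rw [e2, ← hh', LinearMap.comp_apply π, hα]
      rfl⟩ (g ∘ₗ (LinearMap.range (rstarL Λ q0)).mkQ) (by
        ext f
        have : (LinearMap.range (rstarL Λ q0)).mkQ (rstarL Λ q0 f) = 0 := by simp
        show g _ = 0
        rw [this, map_zero])
    rw [← this]
    show Φ _ = Φ _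
    congr 1
    rw [postcompK_apply, ← LinearMap.comp_assoc, hgh]
    rfl)
  -- `γ - β π` lands in `L`
  have hland : ∀ e, ∃ l, jmap ε l = γ e - β (π e) := by
    intro e
    apply exact_jmap q0 ε hε hex0
    ext u
    rw [map_sub, LinearMap.sub_apply, dmap_apply, dmap_apply, hβ, hΦ, hα, dmap_apply]
    simp
  let jE := LinearEquiv.ofInjective (jmap ε) (jmap_injective ε hε)
  let r : E →ₗ[Λ] L := jE.symm.toLinearMap ∘ₗ
    LinearMap.codRestrict (LinearMap.range (jmap ε)) (γ - β ∘ₗ π) (fun e => hland e)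
  have hr : ∀ l, r (ι l) = l := by
    intro l
    show jE.symm _ = l
    rw [LinearEquiv.symm_apply_eq]
    apply Subtype.ext
    show γ (ι l) - β (π (ι l)) = jmap ε l
    rw [hγ, he.apply_apply_eq_zero, map_zero, sub_zero]
  -- section
  have hker2 : LinearMap.ker π ≤ LinearMap.ker (LinearMap.id - ι ∘ₗ r) := by
    intro e hes
    obtain ⟨l, rfl⟩ := (he e).1 hes
    simp [hr]
  refine ⟨(LinearMap.ker π).liftQ (LinearMap.id - ι ∘ₗ r) hker2 ∘ₗ
      (π.quotKerEquivOfSurjective hπ).symm.toLinearMap, ?_⟩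
  ext x
  obtain ⟨e, rfl⟩ := hπ x
  have : (π.quotKerEquivOfSurjective hπ).symm (π e) = (LinearMap.ker π).mkQ e := by
    rw [LinearEquiv.symm_apply_eq]; rfl
  show π ((LinearMap.ker π).liftQ _ hker2 ((π.quotKerEquivOfSurjective hπ).symm (π e))) = _
  rw [this]
  show π (e - ι (r e)) = π e
  rw [map_sub, he.apply_apply_eq_zero, sub_zero]

end

end Helpers

section SES
variable {R : Type} [Ring R] {X Y Z W : Type} [AddCommGroup X] [Module R X]
  [AddCommGroup Y] [Module R Y] [AddCommGroup Z] [Module R Z] [AddCommGroup W] [Module R W]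

lemma ses_desc {f : X →ₗ[R] Y} {g : Y →ₗ[R] Z} (hg : Function.Surjective g)
    (he : Function.Exact f g) (m : Y →ₗ[R] W) (hm : m ∘ₗ f = 0) :
    ∃ s : Z →ₗ[R] W, s ∘ₗ g = m := by
  have hker : LinearMap.ker g ≤ LinearMap.ker m := by
    intro e hes
    obtain ⟨l, rfl⟩ := (he e).1 hes
    exact LinearMap.congr_fun hm l
  refine ⟨(LinearMap.ker g).liftQ m hker ∘ₗ (g.quotKerEquivOfSurjective hg).symm.toLinearMap, ?_⟩
  ext e
  have : (g.quotKerEquivOfSurjective hg).symm (g e) = (LinearMap.ker g).mkQ e := by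
    rw [LinearEquiv.symm_apply_eq]; rfl
  show (LinearMap.ker g).liftQ m hker ((g.quotKerEquivOfSurjective hg).symm (g e)) = _
  rw [this]; rfl

lemma ses_lift {f : X →ₗ[R] Y} {g : Y →ₗ[R] Z} (hf : Function.Injective f)
    (he : Function.Exact f g) (m : W →ₗ[R] Y) (hm : g ∘ₗ m = 0) :
    ∃ s : W →ₗ[R] X, f ∘ₗ s = m := by
  let jE := LinearEquiv.ofInjective f hf
  refine ⟨jE.symm.toLinearMap ∘ₗ LinearMap.codRestrict (LinearMap.range f) m
    (fun e => (he _).1 (LinearMap.congr_fun hm e)), ?_⟩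
  ext e
  have : jE (jE.symm ⟨m e, (he _).1 (LinearMap.congr_fun hm e)⟩) =
    ⟨m e, (he _).1 (LinearMap.congr_fun hm e)⟩ := jE.apply_symm_apply _
  exact congrArg Subtype.val this

lemma ses_retraction {f : X →ₗ[R] Y} {g : Y →ₗ[R] Z} (hf : Function.Injective f)
    (he : Function.Exact f g) (s : Z →ₗ[R] Y) (hs : g ∘ₗ s = LinearMap.id) :
    ∃ r : Y →ₗ[R] X, r ∘ₗ f = LinearMap.id := by
  obtain ⟨r, hr⟩ := ses_lift hf he (LinearMap.id - s ∘ₗ g) (by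
    rw [LinearMap.comp_sub, ← LinearMap.comp_assoc, hs]; simp)
  refine ⟨r, ?_⟩
  ext x
  apply hf
  have := LinearMap.congr_fun hr (f x)
  simpa [he.apply_apply_eq_zero] using this

lemma ses_section {f : X →ₗ[R] Y} {g : Y →ₗ[R] Z} (hg : Function.Surjective g)
    (he : Function.Exact f g) (r : Y →ₗ[R] X) (hr : r ∘ₗ f = LinearMap.id) :
    ∃ s : Z →ₗ[R] Y, g ∘ₗ s = LinearMap.id := by
  obtain ⟨s, hs⟩ := ses_desc hg he (LinearMap.id - f ∘ₗ r) (by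
    rw [LinearMap.sub_comp, LinearMap.comp_assoc, hr]; simp)
  refine ⟨s, ?_⟩
  ext z
  obtain ⟨y, rfl⟩ := hg z
  have := congrArg g (LinearMap.congr_fun hs y)
  simpa [he.apply_apply_eq_zero] using this

end SES

section Fitting
variable {R : Type} [Ring R] {M : Type} [AddCommGroup M] [Module R M]

lemma fitting_proj [IsNoetherian R M] [IsArtinian R M] (f : Module.End R M) :
    ∃ (n : ℕ), n ≠ 0 ∧ ∃ e : M →ₗ[R] M, e ∘ₗ e = e ∧ LinearMap.range e = LinearMap.range (f ^ n) ∧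
      LinearMap.ker e = LinearMap.ker (f ^ n) := by
  obtain ⟨n, hn, h⟩ := ((Filter.eventually_ge_atTop 1).and
    f.eventually_isCompl_ker_pow_range_pow).exists
  refine ⟨n, by omega, Submodule.projection _ _ h.symm, ?_, ?_, ?_⟩
  · exact Submodule.isIdempotentElem_projection h.symm
  · exact Submodule.range_projection h.symm
  · exact Submodule.ker_projection h.symm

lemma indec_cases [IsNoetherian R M] [IsArtinian R M] (hM : IsIndecomposable R M)
    (f : Module.End R M) : IsUnit f ∨ IsNilpotent f := by
  obtain ⟨n, hn, e, he, hr, hk⟩ := fitting_proj f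
  rcases hM.2 e he with rfl | rfl
  · right
    refine ⟨n, ?_⟩
    rw [LinearMap.range_zero] at hr
    exact LinearMap.range_eq_bot.1 hr.symm
  · left
    rw [LinearMap.ker_id] at hk
    rw [LinearMap.range_id] at hr
    have : IsUnit (f ^ n) := by
      rw [Module.End.isUnit_iff]
      exact ⟨LinearMap.ker_eq_bot.1 hk.symm, LinearMap.range_eq_top.1 hr.symm⟩
    exact (isUnit_pow_iff hn).1 this

lemma indec_local [IsNoetherian R M] [IsArtinian R M] (hM : IsIndecomposable R M)
    (f g : Module.End R M) (h : f + g = 1) : IsUnit f ∨ IsUnit g := by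
  rcases indec_cases hM f with h1 | h1
  · exact Or.inl h1
  · right
    rw [← eq_sub_iff_add_eq'] at h
    rw [h]
    exact h1.isUnit_one_sub

lemma exists_indec_summand [IsArtinian R M] [Nontrivial M] :
    ∃ (A : Submodule R M) (p : M →ₗ[R] A), p ∘ₗ A.subtype = LinearMap.id ∧
      IsIndecomposable R A := by
  obtain ⟨S, ⟨hS0, p, hp⟩, hmin⟩ := IsArtinian.set_has_minimal
    {S : Submodule R M | S ≠ ⊥ ∧ ∃ p : M →ₗ[R] S, p ∘ₗ S.subtype = LinearMap.id}
    ⟨⊤, top_ne_bot, LinearMap.codRestrict ⊤ LinearMap.id (by simp), rfl⟩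
  refine ⟨S, p, hp, (Submodule.nontrivial_iff_ne_bot).2 hS0, ?_⟩
  intro f hf
  by_cases hf0 : f = 0
  · exact Or.inl hf0
  right
  by_contra hne
  have hlt : (LinearMap.range (S.subtype ∘ₗ f)) < S := by
    rw [lt_iff_le_and_ne]
    constructor
    · rintro _ ⟨x, rfl⟩
      exact (f x).2
    · intro heq
      apply hne
      ext x
      have hx : (x : M) ∈ LinearMap.range (S.subtype ∘ₗ f) := by rw [heq]; exact x.2
      obtain ⟨y, hy⟩ := hx
      have hy' : f y = x := Subtype.ext hy
      rw [← hy']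
      have := LinearMap.congr_fun hf y
      simpa using congrArg Subtype.val this
  refine hmin _ ⟨?_, ?_⟩ hlt
  · intro h
    apply hf0
    rw [LinearMap.range_eq_bot] at h
    ext x
    exact LinearMap.congr_fun h x
  · refine ⟨LinearMap.rangeRestrict (S.subtype ∘ₗ f) ∘ₗ p, ?_⟩
    ext ⟨_, x, rfl⟩
    have h1 : p (f x : M) = f x := LinearMap.congr_fun hp (f x)
    have h2 : f (f x) = f x := LinearMap.congr_fun hf x
    show ((f (p (f x : M)) : S) : M) = f x
    rw [h1, h2]

end Fitting

section FTP
variable {R : Type} [Ring R] {X Y Z W : Type} [AddCommGroup X] [Module R X]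
  [AddCommGroup Y] [Module R Y] [AddCommGroup Z] [Module R Z] [AddCommGroup W] [Module R W]

lemma ftp_zero : FactorsThroughProjective R (0 : X →ₗ[R] Y) :=
  ⟨ModuleCat.of R R, (inferInstance : Module.Projective R R), 0, 0, by simp⟩

lemma ftp_add {f g : X →ₗ[R] Y} (hf : FactorsThroughProjective R f)
    (hg : FactorsThroughProjective R g) : FactorsThroughProjective R (f + g) := by
  obtain ⟨U, hU, a, b, rfl⟩ := hf
  obtain ⟨V, hV, c, d, rfl⟩ := hg
  refine ⟨ModuleCat.of R (U × V), (inferInstance : Module.Projective R (U × V)),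
    a.prod c, b.coprod d, ?_⟩
  ext x; simp

lemma ftp_comp_left {f : X →ₗ[R] Y} (hf : FactorsThroughProjective R f) (h : Y →ₗ[R] Z) :
    FactorsThroughProjective R (h ∘ₗ f) := by
  obtain ⟨U, hU, a, b, rfl⟩ := hf
  exact ⟨U, hU, a, h ∘ₗ b, rfl⟩

lemma ftp_neg {f : X →ₗ[R] Y} (hf : FactorsThroughProjective R f) :
    FactorsThroughProjective R (-f) := by
  have := ftp_comp_left hf (-LinearMap.id)
  convert this using 1
  ext; simp

lemma ftp_trans {f g h : X →ₗ[R] Y} (h1 : FactorsThroughProjective R (f - g))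
    (h2 : FactorsThroughProjective R (g - h)) : FactorsThroughProjective R (f - h) := by
  have := ftp_add h1 h2
  rwa [sub_add_sub_cancel] at this

lemma ftp_symm {f g : X →ₗ[R] Y} (h1 : FactorsThroughProjective R (f - g)) :
    FactorsThroughProjective R (g - f) := by
  have := ftp_neg h1
  rwa [neg_sub] at this

lemma ftp_congr_left {f g : X →ₗ[R] Y} (h1 : FactorsThroughProjective R (f - g))
    (h : Y →ₗ[R] Z) : FactorsThroughProjective R (h ∘ₗ f - h ∘ₗ g) := by
  have := ftp_comp_left h1 h
  rwa [LinearMap.comp_sub] at this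

lemma ftp_refl (f : X →ₗ[R] Y) : FactorsThroughProjective R (f - f) := by
  rw [sub_self]; exact ftp_zero

end FTP

section AR
variable {R : Type} [Ring R]

lemma left_almost_split_of_right (𝓝 : Set (ModuleCat.{0} R)) (hext : ClosedUnderExtensions R 𝓝)
    {L B A : Type} [AddCommGroup L] [Module R L] [AddCommGroup B] [Module R B]
    [AddCommGroup A] [Module R A] [IsNoetherian R L] [IsArtinian R L]
    (hL : IsIndecomposable R L) (hA : ModuleCat.of R A ∈ 𝓝)
    (f : L →ₗ[R] B) (g : B →ₗ[R] A) (hf : Function.Injective f) (hg : Function.Surjective g)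
    (he : Function.Exact f g) (hr : IsRightAlmostSplit R 𝓝 g) : IsLeftAlmostSplit R 𝓝 f := by
  refine ⟨fun ⟨r, h⟩ => hr.1 (ses_section hg he r h), ?_⟩
  intro X hX h hns
  let W : Submodule R (X × B) := LinearMap.range (LinearMap.prod h (-f))
  let i : X →ₗ[R] ((X × B) ⧸ W) := W.mkQ ∘ₗ LinearMap.inl R X B
  let u : B →ₗ[R] ((X × B) ⧸ W) := W.mkQ ∘ₗ LinearMap.inr R X B
  let g' : ((X × B) ⧸ W) →ₗ[R] A := W.liftQ (g ∘ₗ LinearMap.snd R X B) (by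
    rintro _ ⟨l, rfl⟩
    show g (-f l) = 0
    rw [map_neg, he.apply_apply_eq_zero, neg_zero])
  have hiu : i ∘ₗ h = u ∘ₗ f := by
    ext l
    show W.mkQ (h l, 0) = W.mkQ (0, f l)
    rw [← sub_eq_zero, ← map_sub]
    rw [Submodule.mkQ_apply, Submodule.Quotient.mk_eq_zero]
    exact ⟨l, by simp⟩
  have hg'u : g' ∘ₗ u = g := rfl
  have hi : Function.Injective i := by
    rw [injective_iff_map_eq_zero]
    intro x hx
    have hx' : W.mkQ (x, 0) = 0 := hx
    rw [Submodule.mkQ_apply, Submodule.Quotient.mk_eq_zero] at hx'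
    obtain ⟨l, hl⟩ := hx'
    have h1 : h l = x := congrArg Prod.fst hl
    have h2 : -f l = 0 := congrArg Prod.snd hl
    have h3 : l = 0 := by
      apply hf; rw [map_zero]; exact neg_eq_zero.1 h2
    rw [← h1, h3, map_zero]
  have hg' : Function.Surjective g' := by
    intro a
    obtain ⟨b, rfl⟩ := hg a
    exact ⟨u b, rfl⟩
  have he' : Function.Exact i g' := by
    intro z
    obtain ⟨⟨x, b⟩, rfl⟩ := W.mkQ_surjective z
    constructor
    · intro hz
      have hz' : g b = 0 := hz
      obtain ⟨l, rfl⟩ := (he b).1 hz'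
      refine ⟨x + h l, ?_⟩
      show W.mkQ (x + h l, 0) = W.mkQ (x, f l)
      rw [← sub_eq_zero, ← map_sub]
      rw [Submodule.mkQ_apply, Submodule.Quotient.mk_eq_zero]
      exact ⟨l, by simp⟩
    · rintro ⟨y, hy⟩
      rw [← hy]
      show g 0 = 0
      rw [map_zero]
  have hB' : ModuleCat.of R ((X × B) ⧸ W) ∈ 𝓝 :=
    hext X (ModuleCat.of R ((X × B) ⧸ W)) (ModuleCat.of R A) i g' hi hg' he' hX hA
  by_cases hsp : ∃ s : A →ₗ[R] ((X × B) ⧸ W), g' ∘ₗ s = LinearMap.id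
  · obtain ⟨s, hs⟩ := hsp
    obtain ⟨r, hr⟩ := ses_retraction hi he' s hs
    refine ⟨r ∘ₗ u, ?_⟩
    rw [LinearMap.comp_assoc, ← hiu, ← LinearMap.comp_assoc, hr, LinearMap.id_comp]
  · exfalso
    obtain ⟨v, hv⟩ := hr.2 (ModuleCat.of R ((X × B) ⧸ W)) hB' g' hsp
    obtain ⟨v', hv'⟩ := ses_lift hf he (v ∘ₗ i) (by
      rw [← LinearMap.comp_assoc, hv]
      ext x; exact he'.apply_apply_eq_zero x)
    let w : Module.End R L := v' ∘ₗ h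
    let z : Module.End R B := v ∘ₗ u
    have hwz : ∀ l, f (w l) = z (f l) := by
      intro l
      have h1 : f (v' (h l)) = v (i (h l)) := LinearMap.congr_fun hv' (h l)
      have h2 : i (h l) = u (f l) := LinearMap.congr_fun hiu l
      show f (v' (h l)) = v (u (f l))
      rw [h1, h2]
    have hgz : ∀ b, g (z b) = g b := by
      intro b
      exact LinearMap.congr_fun hv (u b)
    rcases indec_cases hL w with hw | ⟨n, hn⟩
    · apply hns
      obtain ⟨w', hw'⟩ := hw.exists_left_inv
      exact ⟨w' ∘ₗ v', hw'⟩
    · have hwzn : ∀ m l, f ((w ^ m) l) = (z ^ m) (f l) := by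
        intro m
        induction m with
        | zero => intro l; rfl
        | succ m ih =>
          intro l
          rw [pow_succ, pow_succ, Module.End.mul_apply, Module.End.mul_apply, ih, hwz]
      have hgzn : ∀ m b, g ((z ^ m) b) = g b := by
        intro m
        induction m with
        | zero => intro l; rfl
        | succ m ih =>
          intro l
          rw [pow_succ, Module.End.mul_apply, ih, hgz]
      obtain ⟨s, hs⟩ := ses_desc hg he (z ^ n) (by
        ext l
        show (z ^ n) (f l) = 0
        rw [← hwzn, hn]; simp)
      apply hr.1
      refine ⟨s, ?_⟩
      ext a
      obtain ⟨b, rfl⟩ := hg a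
      have : s (g b) = (z ^ n) b := LinearMap.congr_fun hs b
      show g (s (g b)) = g b
      rw [this, hgzn]

lemma exists_minimal_preenvelope (𝓝 : Set (ModuleCat.{0} R)) (hsum : ClosedUnderSummands R 𝓝)
    {T : Type} [AddCommGroup T] [Module R T] (N : ModuleCat.{0} R) (hN : N ∈ 𝓝)
    [IsNoetherian R N] [IsArtinian R N] (μ : T →ₗ[R] N)
    (hμ : ∀ X ∈ 𝓝, ∀ t : T →ₗ[R] X, ∃ μ' : N →ₗ[R] X, FactorsThroughProjective R (μ' ∘ₗ μ - t)) :
    ∃ (S : Submodule R N) (ν : T →ₗ[R] S), ModuleCat.of R S ∈ 𝓝 ∧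
      (∀ X ∈ 𝓝, ∀ t : T →ₗ[R] X, ∃ μ' : S →ₗ[R] X, FactorsThroughProjective R (μ' ∘ₗ ν - t)) ∧
      ∀ θ : Module.End R S, FactorsThroughProjective R (θ ∘ₗ ν - ν) → IsUnit θ := by
  obtain ⟨S, ⟨⟨p, hp⟩, ν, hν⟩, hmin⟩ := IsArtinian.set_has_minimal
    {S : Submodule R N | (∃ p : N →ₗ[R] S, p ∘ₗ S.subtype = LinearMap.id) ∧
      ∃ ν : T →ₗ[R] S, FactorsThroughProjective R (S.subtype ∘ₗ ν - μ)}
    ⟨⊤, ⟨LinearMap.codRestrict ⊤ LinearMap.id (by simp), rfl⟩,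
      LinearMap.codRestrict ⊤ μ (by simp), by
        have : (⊤ : Submodule R N).subtype ∘ₗ LinearMap.codRestrict ⊤ μ (by simp) = μ := rfl
        rw [this]; exact ftp_refl μ⟩
  refine ⟨S, ν, hsum (ModuleCat.of R S) N S.subtype p hp hN, ?_, ?_⟩
  · intro X hX t
    obtain ⟨μ', h⟩ := hμ X hX t
    refine ⟨μ' ∘ₗ S.subtype, ?_⟩
    rw [LinearMap.comp_assoc]
    exact ftp_trans (ftp_congr_left hν μ') h
  · intro θ hθ
    obtain ⟨n, hn, e, he, hr, hk⟩ := fitting_proj θ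
    have hpow : ∀ m : ℕ, FactorsThroughProjective R ((θ ^ m) ∘ₗ ν - ν) := by
      intro m
      induction m with
      | zero => exact ftp_refl ν
      | succ m ih =>
        have h1 := ftp_congr_left ih θ
        have h2 := ftp_trans h1 hθ
        rw [pow_succ']
        exact h2
    by_contra hnu
    have hlt : (LinearMap.range (S.subtype ∘ₗ e)) < S := by
      rw [lt_iff_le_and_ne]
      constructor
      · rintro _ ⟨x, rfl⟩
        exact (e x).2
      · intro heq
        apply hnu
        have hsurj : Function.Surjective e := by
          intro x
          have hx : (x : N) ∈ LinearMap.range (S.subtype ∘ₗ e) := by rw [heq]; exact x.2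
          obtain ⟨y, hy⟩ := hx
          exact ⟨y, Subtype.ext hy⟩
        have hinj : Function.Injective e := by
          intro x y hxy
          obtain ⟨x, rfl⟩ := hsurj x
          obtain ⟨y, rfl⟩ := hsurj y
          have h1 : e (e x) = e x := LinearMap.congr_fun he x
          have h2 : e (e y) = e y := LinearMap.congr_fun he y
          rw [h1, h2] at hxy
          exact hxy
        rw [LinearMap.range_eq_top.2 hsurj] at hr
        rw [LinearMap.ker_eq_bot.2 hinj] at hk
        have : IsUnit (θ ^ n) := by
          rw [Module.End.isUnit_iff]
          exact ⟨LinearMap.ker_eq_bot.1 hk.symm, LinearMap.range_eq_top.1 hr.symm⟩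
        exact (isUnit_pow_iff hn).1 this
    refine hmin _ ⟨?_, ?_⟩ hlt
    · refine ⟨LinearMap.rangeRestrict (S.subtype ∘ₗ e) ∘ₗ p, ?_⟩
      ext ⟨_, x, rfl⟩
      have h1 : p (e x : N) = e x := LinearMap.congr_fun hp (e x)
      have h2 : e (e x) = e x := LinearMap.congr_fun he x
      show ((e (p (e x : N)) : S) : N) = e x
      rw [h1, h2]
    · refine ⟨LinearMap.codRestrict _ (S.subtype ∘ₗ (θ ^ n) ∘ₗ ν) ?_, ?_⟩
      · intro t
        have : (θ ^ n) (ν t) ∈ LinearMap.range e := by rw [hr]; exact ⟨_, rfl⟩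
        obtain ⟨y, hy⟩ := this
        exact ⟨y, congrArg Subtype.val hy⟩
      · exact ftp_trans (ftp_congr_left (hpow n) S.subtype) hν

lemma closed_pow (𝓝 : Set (ModuleCat.{0} R)) (hext : ClosedUnderExtensions R 𝓝)
    (hsum : ClosedUnderSummands R 𝓝) (A : ModuleCat.{0} R) (hA : A ∈ 𝓝) (n : ℕ) :
    ModuleCat.of R (Fin n → A) ∈ 𝓝 := by
  induction n with
  | zero =>
    refine hsum (ModuleCat.of R (Fin 0 → A)) A 0 0 ?_ hA
    refine LinearMap.ext fun x => funext fun i => i.elim0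
  | succ n ih =>
    have h1 : Function.Injective (LinearMap.single R (fun _ : Fin (n + 1) => (A : Type)) 0) := by
      intro a b h
      simpa using congrFun h 0
    have h2 : Function.Surjective (LinearMap.funLeft R A (Fin.succ : Fin n → Fin (n + 1))) := by
      intro x
      exact ⟨Fin.cons 0 x, by ext i; simp [LinearMap.funLeft_apply]⟩
    have h3 : Function.Exact (LinearMap.single R (fun _ : Fin (n + 1) => (A : Type)) 0)
        (LinearMap.funLeft R A (Fin.succ : Fin n → Fin (n + 1))) := by
      intro x
      constructor
      · intro hx
        refine ⟨x 0, ?_⟩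
        ext i
        refine Fin.cases ?_ (fun j => ?_) i
        · simp
        · have := congrFun hx j
          simpa [LinearMap.funLeft_apply] using this.symm
      · rintro ⟨a, rfl⟩
        ext j
        simp [LinearMap.funLeft_apply]
    exact hext A (ModuleCat.of R (Fin (n + 1) → A)) (ModuleCat.of R (Fin n → A)) _ _ h1 h2 h3 hA ih

end AR

section Directions
variable {k Λ : Type} [Field k] [Ring Λ] [Algebra k Λ] [FiniteDimensional k Λ]

lemma preenvelope_of_ar
    (𝓛 : Set (ModuleCat.{0} Λ))
    (hfg : ∀ X ∈ 𝓛, Module.Finite Λ ↥X)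
    (hext : ClosedUnderExtensions Λ 𝓛)
    (hsum : ClosedUnderSummands Λ 𝓛)
    {L Q0 Q1 Q2 : Type} [AddCommGroup L] [Module k L] [Module Λ L] [IsScalarTower k Λ L]
    [SMulCommClass Λ k L] [FiniteDimensional k L]
    [AddCommGroup Q0] [Module Λᵐᵒᵖ Q0]
    [Module k Q0] [IsScalarTower k Λᵐᵒᵖ Q0] [SMulCommClass Λᵐᵒᵖ k Q0]
    [AddCommGroup Q1] [Module Λᵐᵒᵖ Q1]
    [Module k Q1] [IsScalarTower k Λᵐᵒᵖ Q1] [SMulCommClass Λᵐᵒᵖ k Q1]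
    [AddCommGroup Q2] [Module Λᵐᵒᵖ Q2]
    [Module.Finite Λᵐᵒᵖ Q0] [Module.Projective Λᵐᵒᵖ Q0]
    [Module.Finite Λᵐᵒᵖ Q1] [Module.Projective Λᵐᵒᵖ Q1]
    (q0 : Q1 →ₗ[Λᵐᵒᵖ] Q0) (q1 : Q2 →ₗ[Λᵐᵒᵖ] Q1) (ε : Q0 →ₗ[Λᵐᵒᵖ] (L →ₗ[k] k))
    (hε : Function.Surjective ε) (hex0 : Function.Exact q0 ε) (hex : Function.Exact q1 q0)
    (B A : ModuleCat.{0} Λ) (f : L →ₗ[Λ] ↥B) (g : ↥B →ₗ[Λ] ↥A)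
    (har : IsAuslanderReitenSequence Λ 𝓛 f g) :
    ∃ N ∈ 𝓛, ∃ μ : ((Q1 →ₗ[Λᵐᵒᵖ] Λ) ⧸ LinearMap.range (rstarL Λ q0)) →ₗ[Λ] ↥N,
        ∀ X ∈ 𝓛, ∀ t : ((Q1 →ₗ[Λᵐᵒᵖ] Λ) ⧸ LinearMap.range (rstarL Λ q0)) →ₗ[Λ] ↥X,
            ∃ μ' : ↥N →ₗ[Λ] ↥X, FactorsThroughProjective Λ (μ' ∘ₗ μ - t) := by
  obtain ⟨hL, hB, hA, hf, hg, he, hl, hr⟩ := har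
  let _ : Module k A := Module.compHom A (algebraMap k Λ)
  have _ : IsScalarTower k Λ A := IsScalarTower.of_compHom k Λ A
  have _ : SMulCommClass Λ k A := IsScalarTower.to_smulCommClass'
  have _ : Module.Finite Λ A := hfg A hA
  have _ : Module.Finite k A := Module.Finite.trans Λ A
  have hfin : Module.Finite k (((Q1 →ₗ[Λᵐᵒᵖ] Λ) ⧸ LinearMap.range (rstarL Λ q0)) →ₗ[Λ] A) := by
    obtain ⟨m, b, c, hbc⟩ := exists_dual_basis (Λ := Λ) Q1
    let Θ : (((Q1 →ₗ[Λᵐᵒᵖ] Λ) ⧸ LinearMap.range (rstarL Λ q0)) →ₗ[Λ] A) →ₗ[k] (Fin m → A) :=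
      { toFun := fun t i => t ((LinearMap.range (rstarL Λ q0)).mkQ (c i))
        map_add' := fun _ _ => rfl
        map_smul' := fun _ _ => rfl }
    refine Module.Finite.of_injective Θ ?_
    intro t t' htt
    apply Submodule.linearMap_qext
    rw [expand_ev hbc (t ∘ₗ _), expand_ev hbc (t' ∘ₗ _)]
    refine Finset.sum_congr rfl fun i _ => ?_
    have : t ((LinearMap.range (rstarL Λ q0)).mkQ (c i)) =
      t' ((LinearMap.range (rstarL Λ q0)).mkQ (c i)) := congrFun htt i
    rw [LinearMap.comp_apply, LinearMap.comp_apply, this]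
  obtain ⟨n, s, hs⟩ := Module.Finite.exists_fin (R := k)
    (M := ((Q1 →ₗ[Λᵐᵒᵖ] Λ) ⧸ LinearMap.range (rstarL Λ q0)) →ₗ[Λ] A)
  refine ⟨ModuleCat.of Λ (Fin n → A), closed_pow 𝓛 hext hsum A hA n, LinearMap.pi s, ?_⟩
  intro X hX t
  let _ : Module k X := Module.compHom X (algebraMap k Λ)
  have _ : IsScalarTower k Λ X := IsScalarTower.of_compHom k Λ X
  have _ : SMulCommClass Λ k X := IsScalarTower.to_smulCommClass'
  let G : Submodule k (((Q1 →ₗ[Λᵐᵒᵖ] Λ) ⧸ LinearMap.range (rstarL Λ q0)) →ₗ[Λ] X) :=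
    { carrier := {τ | ∃ μ' : (Fin n → A) →ₗ[Λ] X,
        FactorsThroughProjective Λ (μ' ∘ₗ LinearMap.pi s - τ)}
      add_mem' := by
        rintro a b ⟨m1, h1⟩ ⟨m2, h2⟩
        refine ⟨m1 + m2, ?_⟩
        have := ftp_add h1 h2
        rw [LinearMap.add_comp]
        convert this using 1
        abel
      zero_mem' := ⟨0, by rw [LinearMap.zero_comp]; exact ftp_refl 0⟩
      smul_mem' := by
        rintro c a ⟨m1, h1⟩
        refine ⟨c • m1, ?_⟩
        have := ftp_comp_left h1 (c • LinearMap.id)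
        convert this using 1
        ext; simp [smul_sub] }
  by_contra hcon
  have htG : t ∉ G := hcon
  obtain ⟨ψ, hψt, hψG⟩ := Submodule.exists_le_ker_of_notMem htG
  obtain ⟨E, ι, π, hι, hπ, hιπ, hlift⟩ := extension_of_functional q0 q1 ε hε hex0 hex ψ (by
    intro τ hτ
    apply hψG
    refine ⟨0, ?_⟩
    rw [LinearMap.zero_comp, zero_sub]
    exact ftp_neg hτ)
  have hE : E ∈ 𝓛 := hext (ModuleCat.of Λ L) E X ι π hι hπ hιπ hL hX
  obtain ⟨w, hw⟩ := hl.2 E hE ι (by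
    rintro ⟨r, hr⟩
    obtain ⟨σ, hσ⟩ := ses_section hπ hιπ r hr
    have := (hlift X LinearMap.id).1 ⟨σ, hσ⟩ t
    exact hψt this)
  obtain ⟨h, hh⟩ := ses_desc hg he (π ∘ₗ w) (by
    rw [LinearMap.comp_assoc, hw]
    ext l; exact hιπ.apply_apply_eq_zero l)
  obtain ⟨h', hh'⟩ := (hlift A h).2 (by
    intro τ
    apply hψG
    have hτ : τ ∈ Submodule.span k (Set.range s) := by rw [hs]; trivial
    obtain ⟨c, hc⟩ := (Submodule.mem_span_range_iff_exists_fun k).1 hτ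
    refine ⟨h ∘ₗ ∑ i, c i • LinearMap.proj i, ?_⟩
    have : (h ∘ₗ ∑ i, c i • LinearMap.proj (R := Λ) (φ := fun _ : Fin n => (A : Type)) i) ∘ₗ
        LinearMap.pi s = h ∘ₗ τ := by
      rw [← hc]
      ext x
      simp
    rw [this]
    exact ftp_refl _)
  obtain ⟨r, hr'⟩ := ses_lift hι hιπ (w - h' ∘ₗ g) (by
    rw [LinearMap.comp_sub, ← LinearMap.comp_assoc, hh', hh, sub_self])
  apply hl.1
  refine ⟨r, ?_⟩
  ext l
  apply hι
  have h1 : ι (r (f l)) = w (f l) - h' (g (f l)) := LinearMap.congr_fun hr' (f l)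
  have h2 : w (f l) = ι l := LinearMap.congr_fun hw l
  show ι (r (f l)) = ι l
  rw [h1, h2, he.apply_apply_eq_zero, map_zero, sub_zero]

lemma ar_of_preenvelope
    (𝓛 : Set (ModuleCat.{0} Λ))
    (hfg : ∀ X ∈ 𝓛, Module.Finite Λ ↥X)
    (hext : ClosedUnderExtensions Λ 𝓛)
    (hsum : ClosedUnderSummands Λ 𝓛)
    {L Q0 Q1 Q2 : Type} [AddCommGroup L] [Module k L] [Module Λ L] [IsScalarTower k Λ L]
    [SMulCommClass Λ k L] [FiniteDimensional k L] [Module.Finite Λ L]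
    (hL : ModuleCat.of Λ L ∈ 𝓛)
    (hLind : IsIndecomposable Λ L)
    (Lt : ModuleCat.{0} Λ) (hLt : Lt ∈ 𝓛)
    (hExt1 : HasNonSplitExtension Λ ↥Lt L)
    [AddCommGroup Q0] [Module Λᵐᵒᵖ Q0]
    [Module k Q0] [IsScalarTower k Λᵐᵒᵖ Q0] [SMulCommClass Λᵐᵒᵖ k Q0]
    [AddCommGroup Q1] [Module Λᵐᵒᵖ Q1]
    [Module k Q1] [IsScalarTower k Λᵐᵒᵖ Q1] [SMulCommClass Λᵐᵒᵖ k Q1]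
    [AddCommGroup Q2] [Module Λᵐᵒᵖ Q2]
    [Module.Finite Λᵐᵒᵖ Q0] [Module.Projective Λᵐᵒᵖ Q0]
    [Module.Finite Λᵐᵒᵖ Q1] [Module.Projective Λᵐᵒᵖ Q1]
    (q0 : Q1 →ₗ[Λᵐᵒᵖ] Q0) (q1 : Q2 →ₗ[Λᵐᵒᵖ] Q1) (ε : Q0 →ₗ[Λᵐᵒᵖ] (L →ₗ[k] k))
    (hε : Function.Surjective ε) (hex0 : Function.Exact q0 ε) (hex : Function.Exact q1 q0)
    (N0 : ModuleCat.{0} Λ) (hN0 : N0 ∈ 𝓛)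
    (μ0 : ((Q1 →ₗ[Λᵐᵒᵖ] Λ) ⧸ LinearMap.range (rstarL Λ q0)) →ₗ[Λ] ↥N0)
    (hμ0 : ∀ X ∈ 𝓛, ∀ t : ((Q1 →ₗ[Λᵐᵒᵖ] Λ) ⧸ LinearMap.range (rstarL Λ q0)) →ₗ[Λ] ↥X,
            ∃ μ' : ↥N0 →ₗ[Λ] ↥X, FactorsThroughProjective Λ (μ' ∘ₗ μ0 - t)) :
    ∃ (B A : ModuleCat.{0} Λ) (f : L →ₗ[Λ] ↥B) (g : ↥B →ₗ[Λ] ↥A),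
      IsAuslanderReitenSequence Λ 𝓛 f g := by
  have _ : IsArtinianRing Λ := IsArtinianRing.of_finite k Λ
  have _ : IsNoetherianRing Λ := IsNoetherianRing.of_finite k Λ
  have _ : Module.Finite Λ N0 := hfg N0 hN0
  obtain ⟨N, μ, hN, hμ, hmin⟩ := exists_minimal_preenvelope 𝓛 hsum N0 hN0 μ0 hμ0
  have hNnt : Nontrivial N := by
    by_contra hnt
    rw [not_nontrivial_iff_subsingleton] at hnt
    obtain ⟨E, ι, π, hι, hπ, hιπ, hns⟩ := hExt1
    apply hns
    refine split_of_stable_zero q0 q1 ε hε hex0 hex ?_ ι π hι hπ hιπ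
    intro t
    obtain ⟨μ', h⟩ := hμ Lt hLt t
    have h0 : μ = 0 := LinearMap.ext fun _ => Subsingleton.elim _ _
    rw [h0, LinearMap.comp_zero, zero_sub] at h
    have := ftp_neg h
    rwa [neg_neg] at this
  obtain ⟨A, i, p, hp, hAind⟩ : ∃ (A : ModuleCat.{0} Λ) (i : A →ₗ[Λ] N) (p : N →ₗ[Λ] A),
      p ∘ₗ i = LinearMap.id ∧ IsIndecomposable Λ A := by
    obtain ⟨A, p, hp, hAind⟩ := exists_indec_summand (R := Λ) (M := N)
    exact ⟨ModuleCat.of Λ A, A.subtype, p, hp, hAind⟩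
  have hA : A ∈ 𝓛 := hsum A (ModuleCat.of Λ N) i p hp hN
  have _ : Module.Finite Λ A := hfg A hA
  let _ : Module k A := Module.compHom A (algebraMap k Λ)
  have _ : IsScalarTower k Λ A := IsScalarTower.of_compHom k Λ A
  have _ : SMulCommClass Λ k A := IsScalarTower.to_smulCommClass'
  let S : Submodule k (((Q1 →ₗ[Λᵐᵒᵖ] Λ) ⧸ LinearMap.range (rstarL Λ q0)) →ₗ[Λ] A) :=
    { carrier := {τ | ∃ w : N →ₗ[Λ] A, (¬ ∃ s : A →ₗ[Λ] N, w ∘ₗ s = LinearMap.id) ∧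
        FactorsThroughProjective Λ (w ∘ₗ μ - τ)}
      add_mem' := by
        rintro a b ⟨w1, n1, h1⟩ ⟨w2, n2, h2⟩
        refine ⟨w1 + w2, ?_, ?_⟩
        · rintro ⟨s, hs⟩
          rw [LinearMap.add_comp] at hs
          rcases indec_local hAind (w1 ∘ₗ s) (w2 ∘ₗ s) hs with hu | hu
          · obtain ⟨v, hv⟩ := hu.exists_right_inv
            exact n1 ⟨s ∘ₗ v, hv⟩
          · obtain ⟨v, hv⟩ := hu.exists_right_inv
            exact n2 ⟨s ∘ₗ v, hv⟩
        · have := ftp_add h1 h2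
          rw [LinearMap.add_comp]
          convert this using 1
          abel
      zero_mem' := by
        refine ⟨0, ?_, by rw [LinearMap.zero_comp]; exact ftp_refl 0⟩
        rintro ⟨s, hs⟩
        have _ := hAind.1
        obtain ⟨a, ha⟩ := exists_ne (0 : A)
        exact ha (LinearMap.congr_fun hs a).symm
      smul_mem' := by
        rintro c a ⟨w, n, h1⟩
        refine ⟨c • w, ?_, ?_⟩
        · rintro ⟨s, hs⟩
          refine n ⟨s ∘ₗ (c • LinearMap.id), ?_⟩
          apply LinearMap.ext
          intro x
          have h2 := LinearMap.congr_fun hs x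
          have h3 : w (s (c • x)) = c • w (s x) := lin_algebraMap (k := k) (w ∘ₗ s) c x
          have h4 : c • w (s x) = x := h2
          show w (s (c • x)) = x
          rw [h3, h4]
        · have := ftp_comp_left h1 (c • LinearMap.id)
          convert this using 1
          ext; simp [smul_sub] }
  have hpS : p ∘ₗ μ ∉ S := by
    rintro ⟨w, hw, h⟩
    let θ : Module.End Λ N := LinearMap.id - i ∘ₗ p + i ∘ₗ w
    have hθ : FactorsThroughProjective Λ (θ ∘ₗ μ - μ) := by
      have := ftp_comp_left h i
      convert this using 1
      ext x
      simp [θ]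
      abel
    obtain ⟨θ', hθ'⟩ := (hmin θ hθ).exists_right_inv
    have hpa : ∀ a : A, p (i a) = a := fun a => LinearMap.congr_fun hp a
    have hpθ : ∀ x, p (θ x) = w x := by
      intro x
      have : θ x = x - i (p x) + i (w x) := rfl
      rw [this, map_add, map_sub, hpa, hpa, sub_self, zero_add]
    apply hw
    refine ⟨θ' ∘ₗ i, ?_⟩
    apply LinearMap.ext
    intro a
    have h1 : θ (θ' (i a)) = i a := LinearMap.congr_fun hθ' (i a)
    show w (θ' (i a)) = a
    rw [← hpθ, h1, hpa]
  obtain ⟨φ, hφp, hφS⟩ := Submodule.exists_le_ker_of_notMem hpS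
  obtain ⟨B, f, g, hf, hg, he, hlift⟩ := extension_of_functional q0 q1 ε hε hex0 hex φ (by
    intro τ hτ
    apply hφS
    obtain ⟨w, hw, h⟩ := S.zero_mem
    refine ⟨w, hw, ?_⟩
    refine ftp_trans h ?_
    rw [zero_sub]
    exact ftp_neg hτ)
  have hB : B ∈ 𝓛 := hext (ModuleCat.of Λ L) B A f g hf hg he hL hA
  have hright : IsRightAlmostSplit Λ 𝓛 g := by
    constructor
    · intro hs
      exact hφp ((hlift A LinearMap.id).1 hs (p ∘ₗ μ))
    · intro X hX h hns
      refine (hlift X h).2 fun t => ?_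
      apply hφS
      obtain ⟨s, hs⟩ := hμ X hX t
      refine ⟨h ∘ₗ s, ?_, ?_⟩
      · rintro ⟨v, hv⟩
        exact hns ⟨s ∘ₗ v, hv⟩
      · exact ftp_congr_left hs h
  exact ⟨B, A, f, g, hL, hB, hA, hf, hg, he,
    left_almost_split_of_right 𝓛 hext hLind hA f g hf hg he hright, hright⟩

end Directions

/-- **Theorem (existence of left Auslander-Reiten sequences in subcategories).**
Let `𝓛` be a subcategory of `mod Λ` closed under extensions and direct summands, and let
`L` be an indecomposable module in `𝓛` with `Ext¹(L̃, L) ≠ 0` for some `L̃` in `𝓛`.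
Then `TrD L` has an `𝓛`-preenvelope in the projective stable category iff there is an
Auslander-Reiten sequence `0 → L → B → A → 0` in `𝓛`. -/
theorem ar_sequence_exists_iff_stable_preenvelope
    (k Λ : Type) [Field k] [Ring Λ] [Algebra k Λ] [FiniteDimensional k Λ]
    (𝓛 : Set (ModuleCat.{0} Λ))
    (hfg : ∀ X ∈ 𝓛, Module.Finite Λ ↥X)
    (hiso : ClosedUnderIso Λ 𝓛)
    (hext : ClosedUnderExtensions Λ 𝓛)
    (hsum : ClosedUnderSummands Λ 𝓛)
    (L : Type) [AddCommGroup L] [Module k L] [Module Λ L] [IsScalarTower k Λ L]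
    [SMulCommClass Λ k L] [Module.Finite Λ L]
    (hL : ModuleCat.of Λ L ∈ 𝓛)
    (hLind : IsIndecomposable Λ L)
    (Lt : ModuleCat.{0} Λ) (hLt : Lt ∈ 𝓛)
    (hExt1 : HasNonSplitExtension Λ ↥Lt L)
    -- a projective resolution `⋯ → Q₂ → Q₁ → Q₀ → DL → 0` of the right `Λ`-module
    -- `DL = Hom_k(L, k)` by finitely generated projective right `Λ`-modules
    (Q : ℕ → Type) [∀ n, AddCommGroup (Q n)] [∀ n, Module Λᵐᵒᵖ (Q n)]
    (hQfin : ∀ n, Module.Finite Λᵐᵒᵖ (Q n)) (hQproj : ∀ n, Module.Projective Λᵐᵒᵖ (Q n))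
    (q : ∀ n, Q (n + 1) →ₗ[Λᵐᵒᵖ] Q n) (ε : Q 0 →ₗ[Λᵐᵒᵖ] (L →ₗ[k] k))
    (hε : Function.Surjective ε) (hex0 : Function.Exact (q 0) ε)
    (hex : ∀ n, Function.Exact (q (n + 1)) (q n)) :
    -- (i) `TrD L = coker (q₁* : Q₀* → Q₁*)` has an `𝓛`-preenvelope in the
    -- projective stable category
    (∃ N ∈ 𝓛, ∃ μ : ((Q 1 →ₗ[Λᵐᵒᵖ] Λ) ⧸ LinearMap.range (rstarL Λ (q 0))) →ₗ[Λ] ↥N,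
        ∀ X ∈ 𝓛, ∀ t : ((Q 1 →ₗ[Λᵐᵒᵖ] Λ) ⧸ LinearMap.range (rstarL Λ (q 0))) →ₗ[Λ] ↥X,
            ∃ μ' : ↥N →ₗ[Λ] ↥X, FactorsThroughProjective Λ (μ' ∘ₗ μ - t))
    ↔
    -- (ii) there is an Auslander-Reiten sequence `0 → L → B → A → 0` in `𝓛`
    (∃ (B A : ModuleCat.{0} Λ) (f : L →ₗ[Λ] ↥B) (g : ↥B →ₗ[Λ] ↥A),
      IsAuslanderReitenSequence Λ 𝓛 f g) := by
  have : IsScalarTower k Λ L := inferInstance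
  have : FiniteDimensional k L := Module.Finite.trans Λ L
  let _ : ∀ n, Module k (Q n) := fun n => Module.compHom (Q n) (algebraMap k Λᵐᵒᵖ)
  have _ : ∀ n, IsScalarTower k Λᵐᵒᵖ (Q n) := fun n => IsScalarTower.of_compHom k Λᵐᵒᵖ (Q n)
  have _ : ∀ n, SMulCommClass Λᵐᵒᵖ k (Q n) := fun n => IsScalarTower.to_smulCommClass'
  constructor
  · rintro ⟨N, hN, μ, hμ⟩
    exact ar_of_preenvelope 𝓛 hfg hext hsum hL hLind Lt hLt hExt1 (q 0) (q 1) ε hε hex0 (hex 0)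
      N hN μ hμ
  · rintro ⟨B, A, f, g, h⟩
    exact preenvelope_of_ar 𝓛 hfg hext hsum (q 0) (q 1) ε hε hex0 (hex 0) B A f g h
end

section
/- Let M and N be finitely generated left Λ-modules, fix a projective resolution ⋯ → P₂ → P₁ → P₀ → M → 0 by finitely generated projectives with the associated maps d₂, d₁, j₁, f₂, and let ν: N → DTr M be a morphism. Let 0 → N →i J⁰ →a J¹ →a¹ J² → ⋯ be an injective resolution of N, and let λ₀: J⁰ → D(P₁*), λ₁: J¹ → D(P₀*) be morphisms satisfying λ₀∘i = j₁∘ν and d₁∘λ₀ = λ₁∘a (a cochain map λ: J → Σ⁻¹D(P*) induced by ν). If there exist morphisms φ⁰: J⁰ → D(P₂*) and φ¹: J¹ → D(P₁*) with λ₀ = d₂∘φ⁰ + φ¹∘a (in particular if λ is null homotopic), then ν = f₂∘φ⁰∘i. -/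
set_option linter.unusedSectionVars false

open MulOpposite

/-- **Lemma.** If the chain map `λ : J → Σ⁻¹D(P*)` induced by `ν : N → DTr M` is
null homotopic (witnessed in degrees `0, 1` by `φ⁰, φ¹`), then `ν = f₂ ∘ φ⁰ ∘ i`. -/
theorem factors_of_nullHomotopic
    (k Λ : Type) [Field k] [Ring Λ] [Algebra k Λ] [FiniteDimensional k Λ]
    (M : Type) [AddCommGroup M] [Module Λ M] [Module.Finite Λ M]
    (N : Type) [AddCommGroup N] [Module Λ N] [Module.Finite Λ N]
    -- a projective resolution `⋯ → P₂ → P₁ → P₀ → M → 0` by finitely generated projectives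
    (P : ℕ → Type) [∀ n, AddCommGroup (P n)] [∀ n, Module Λ (P n)]
    (hPfin : ∀ n, Module.Finite Λ (P n)) (hPproj : ∀ n, Module.Projective Λ (P n))
    (p : ∀ n, P (n + 1) →ₗ[Λ] P n) (ε : P 0 →ₗ[Λ] M)
    (hε : Function.Surjective ε) (hex0 : Function.Exact (p 0) ε)
    (hex : ∀ n, Function.Exact (p (n + 1)) (p n))
    -- `f₂ : D(P₂*) → DTr M` is the corestriction of `d₂ = D(p₂*)` along
    -- `j₁ : DTr M = ker d₁ → D(P₁*)`
    (f₂ : ((P 2 →ₗ[Λ] Λ) →ₗ[k] k) →ₗ[Λ] ↥(LinearMap.ker (ldmap k Λ (p 0))))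
    (hf₂ : (LinearMap.ker (ldmap k Λ (p 0))).subtype ∘ₗ f₂ = ldmap k Λ (p 1))
    -- a morphism `ν : N → DTr M`
    (ν : N →ₗ[Λ] ↥(LinearMap.ker (ldmap k Λ (p 0))))
    -- an injective resolution `0 → N →i J⁰ →a J¹ →a¹ J² → ⋯` of `N`
    (J0 J1 J2 : Type) [AddCommGroup J0] [Module Λ J0] [AddCommGroup J1] [Module Λ J1]
    [AddCommGroup J2] [Module Λ J2]
    (hJ0 : Module.Injective Λ J0) (hJ1 : Module.Injective Λ J1) (hJ2 : Module.Injective Λ J2)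
    (i : N →ₗ[Λ] J0) (a : J0 →ₗ[Λ] J1) (a1 : J1 →ₗ[Λ] J2)
    (hi : Function.Injective i) (hia : Function.Exact i a) (haa1 : Function.Exact a a1)
    -- a chain map `λ : J → Σ⁻¹D(P*)` induced by `ν`
    (lam0 : J0 →ₗ[Λ] ((P 1 →ₗ[Λ] Λ) →ₗ[k] k)) (lam1 : J1 →ₗ[Λ] ((P 0 →ₗ[Λ] Λ) →ₗ[k] k))
    (hlam0 : lam0 ∘ₗ i = (LinearMap.ker (ldmap k Λ (p 0))).subtype ∘ₗ ν)
    (hlam1 : ldmap k Λ (p 0) ∘ₗ lam0 = lam1 ∘ₗ a)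
    -- a null homotopy in degree `0`
    (φ0 : J0 →ₗ[Λ] ((P 2 →ₗ[Λ] Λ) →ₗ[k] k)) (φ1 : J1 →ₗ[Λ] ((P 1 →ₗ[Λ] Λ) →ₗ[k] k))
    (hhtpy : lam0 = ldmap k Λ (p 1) ∘ₗ φ0 + φ1 ∘ₗ a) :
    ν = f₂ ∘ₗ φ0 ∘ₗ i := by
  refine LinearMap.ext fun n => Subtype.ext ?_
  have h1 := LinearMap.congr_fun hlam0 n
  have h2 := LinearMap.congr_fun hf₂ (φ0 (i n))
  have h3 := LinearMap.congr_fun hhtpy (i n)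
  have h4 : a (i n) = 0 := hia.apply_apply_eq_zero n
  rw [LinearMap.add_apply, LinearMap.comp_apply, LinearMap.comp_apply, h4, map_zero,
    add_zero] at h3
  exact h1.symm.trans (h3.trans h2.symm)
end

section
/- Let M be a finitely generated left Λ-module with a projective resolution ⋯ → P₂ →p₂ P₁ →p₁ P₀ → M → 0 by finitely generated projectives, and let U be a finitely generated injective left Λ-module. Then the sequence of k-vector spaces Hom_Λ(U, D(P₂*)) → Hom_Λ(U, D(P₁*)) → Hom_Λ(U, D(P₀*)), with maps given by composition with d₂ = D(p₂*) and d₁ = D(p₁*), is exact at the middle term. -/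
set_option linter.unusedSectionVars false

open MulOpposite

section HomInjAux

variable {k Λ : Type} [Field k] [Ring Λ] [Algebra k Λ]
  {U : Type} [AddCommGroup U] [Module Λ U] [Module k U] [IsScalarTower k Λ U]
  [SMulCommClass Λ k U]

/-- Precomposition on `Hom_Λ(-, U)`. -/
def preU {P' P : Type} [AddCommGroup P'] [Module Λ P'] [AddCommGroup P] [Module Λ P]
    (q : P' →ₗ[Λ] P) : (P →ₗ[Λ] U) →ₗ[k] (P' →ₗ[Λ] U) where
  toFun h := h ∘ₗ q
  map_add' f g := by ext x; simp
  map_smul' c f := by ext x; simp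

variable {P : Type} [AddCommGroup P] [Module Λ P]

/-- The natural map `D(Hom(P, U)) → Hom(U, D(P*))`. -/
def bigPhi (θ : (P →ₗ[Λ] U) →ₗ[k] k) : U →ₗ[Λ] ((P →ₗ[Λ] Λ) →ₗ[k] k) where
  toFun u :=
    { toFun := fun α => θ ((LinearMap.toSpanSingleton Λ U u) ∘ₗ α)
      map_add' := fun α β => by
        rw [← map_add]; congr 1; ext x; simp [add_smul]
      map_smul' := fun c α => by
        rw [RingHom.id_apply, ← map_smul]; congr 1; ext x; simp }
  map_add' u v := by
    ext α
    show θ _ = θ _ + θ _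
    rw [← map_add]; congr 1; ext x; simp
  map_smul' a u := by
    ext α
    show θ _ = θ _
    congr 1; ext x
    show α x • a • u = (α x * a) • u
    rw [mul_smul]

lemma bigPhi_apply (θ : (P →ₗ[Λ] U) →ₗ[k] k) (u : U) (α : P →ₗ[Λ] Λ) :
    bigPhi θ u α = θ ((LinearMap.toSpanSingleton Λ U u) ∘ₗ α) := rfl

lemma dual_basis_exists (Λ P : Type) [Ring Λ] [AddCommGroup P] [Module Λ P]
    [Module.Finite Λ P] [Module.Projective Λ P] :
    ∃ (n : ℕ) (x : Fin n → P) (α : Fin n → (P →ₗ[Λ] Λ)), ∀ y, ∑ i, α i y • x i = y := by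
  obtain ⟨n, π, s, -, -, h⟩ := Module.Finite.exists_comp_eq_id_of_projective Λ P
  refine ⟨n, fun i => π (Pi.single i 1), fun i => LinearMap.proj i ∘ₗ s, fun y => ?_⟩
  have h2 : π (s y) = y := LinearMap.congr_fun h y
  conv_rhs => rw [← h2, pi_eq_sum_univ' (s y)]
  simp only [map_sum, map_smul, LinearMap.comp_apply, LinearMap.proj_apply]

lemma bigPhi_injective [Module.Finite Λ P] [Module.Projective Λ P]
    (θ : (P →ₗ[Λ] U) →ₗ[k] k) (h0 : bigPhi θ = 0) : θ = 0 := by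
  obtain ⟨n, x, α, hx⟩ := dual_basis_exists Λ P
  ext h
  have : h = ∑ i, (LinearMap.toSpanSingleton Λ U (h (x i))) ∘ₗ α i := by
    ext y
    conv_lhs => rw [← hx y]
    simp
  rw [this, map_sum]
  refine Finset.sum_eq_zero fun i _ => ?_
  rw [← bigPhi_apply, h0]; rfl

lemma bigPhi_surjective [Module.Finite Λ P] [Module.Projective Λ P]
    (f : U →ₗ[Λ] ((P →ₗ[Λ] Λ) →ₗ[k] k)) : ∃ θ : (P →ₗ[Λ] U) →ₗ[k] k, bigPhi θ = f := by
  obtain ⟨n, x, α, hx⟩ := dual_basis_exists Λ P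
  refine ⟨{ toFun := fun h => ∑ i, f (h (x i)) (α i), map_add' := ?_, map_smul' := ?_ }, ?_⟩
  · intro g h
    simp [Finset.sum_add_distrib]
  · intro c h
    simp only [RingHom.id_apply, Finset.smul_sum]
    refine Finset.sum_congr rfl fun i _ => ?_
    rw [LinearMap.smul_apply, ← algebraMap_smul Λ c (h (x i)), map_smul,
      dualModuleLeft_smul_apply, ← map_smul]
    congr 1
    ext y
    simp [Algebra.smul_def, Algebra.commutes]
  · ext u β
    rw [bigPhi_apply]
    show ∑ i, f (β (x i) • u) (α i) = f u β
    simp only [map_smul, dualModuleLeft_smul_apply]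
    rw [← map_sum]
    congr 1
    ext y
    conv_rhs => rw [← hx y]
    simp

lemma bigPhi_nat {P' : Type} [AddCommGroup P'] [Module Λ P'] (q : P' →ₗ[Λ] P)
    (θ : (P' →ₗ[Λ] U) →ₗ[k] k) :
    ldmap k Λ q ∘ₗ bigPhi θ = bigPhi (θ ∘ₗ preU q) := rfl

lemma hom_inj_exact (hU : Module.Injective Λ U) {P₀ P₁ P₂ : Type} [AddCommGroup P₀] [Module Λ P₀]
    [AddCommGroup P₁] [Module Λ P₁] [AddCommGroup P₂] [Module Λ P₂]
    (p₁ : P₁ →ₗ[Λ] P₀) (p₂ : P₂ →ₗ[Λ] P₁) (hex : Function.Exact p₂ p₁)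
    (h : P₁ →ₗ[Λ] U) (hh : h ∘ₗ p₂ = 0) : ∃ h' : P₀ →ₗ[Λ] U, h' ∘ₗ p₁ = h := by
  have hk : LinearMap.ker p₁ ≤ LinearMap.ker h := by
    intro y hy
    obtain ⟨z, rfl⟩ := (hex y).1 hy
    exact LinearMap.congr_fun hh z
  obtain ⟨h', hh'⟩ := hU.out ((LinearMap.ker p₁).liftQ p₁ le_rfl)
    (LinearMap.ker_eq_bot.1 (Submodule.ker_liftQ_eq_bot' _ _ rfl))
    ((LinearMap.ker p₁).liftQ h hk)
  exact ⟨h', LinearMap.ext fun y => by simpa using hh' (Submodule.Quotient.mk y)⟩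

lemma aux_main (hU : Module.Injective Λ U) {P₀ P₁ P₂ : Type} [AddCommGroup P₀] [Module Λ P₀]
    [AddCommGroup P₁] [Module Λ P₁] [AddCommGroup P₂] [Module Λ P₂]
    [Module.Finite Λ P₀] [Module.Projective Λ P₀] [Module.Finite Λ P₁] [Module.Projective Λ P₁]
    (p₁ : P₁ →ₗ[Λ] P₀) (p₂ : P₂ →ₗ[Λ] P₁) (hex : Function.Exact p₂ p₁)
    (f : U →ₗ[Λ] ((P₁ →ₗ[Λ] Λ) →ₗ[k] k)) (hf : ldmap k Λ p₁ ∘ₗ f = 0) :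
    ∃ g : U →ₗ[Λ] ((P₂ →ₗ[Λ] Λ) →ₗ[k] k), ldmap k Λ p₂ ∘ₗ g = f := by
  obtain ⟨θ, rfl⟩ := bigPhi_surjective f
  rw [bigPhi_nat] at hf
  have h0 := bigPhi_injective _ hf
  have hmem : θ ∈ LinearMap.range (preU (k := k) (U := U) p₂).dualMap := by
    rw [LinearMap.range_dualMap_eq_dualAnnihilator_ker, Submodule.mem_dualAnnihilator]
    intro h hh
    obtain ⟨h', rfl⟩ := hom_inj_exact hU p₁ p₂ hex h hh
    exact LinearMap.congr_fun h0 h'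
  obtain ⟨θ', hθ'⟩ := hmem
  refine ⟨bigPhi θ', ?_⟩
  rw [bigPhi_nat]
  exact congrArg bigPhi hθ'

end HomInjAux

/-- **Lemma.** For a finitely generated injective `Λ`-module `U`, the sequence
`Hom_Λ(U, D(P₂*)) → Hom_Λ(U, D(P₁*)) → Hom_Λ(U, D(P₀*))` is exact at the middle term. -/
theorem hom_from_injective_exact
    (k Λ : Type) [Field k] [Ring Λ] [Algebra k Λ] [FiniteDimensional k Λ]
    (M : Type) [AddCommGroup M] [Module Λ M] [Module.Finite Λ M]
    -- a projective resolution `⋯ → P₂ → P₁ → P₀ → M → 0` by finitely generated projectives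
    (P : ℕ → Type) [∀ n, AddCommGroup (P n)] [∀ n, Module Λ (P n)]
    (hPfin : ∀ n, Module.Finite Λ (P n)) (hPproj : ∀ n, Module.Projective Λ (P n))
    (p : ∀ n, P (n + 1) →ₗ[Λ] P n) (ε : P 0 →ₗ[Λ] M)
    (hε : Function.Surjective ε) (hex0 : Function.Exact (p 0) ε)
    (hex : ∀ n, Function.Exact (p (n + 1)) (p n))
    -- a finitely generated injective `Λ`-module `U`
    (U : Type) [AddCommGroup U] [Module Λ U] [Module.Finite Λ U]
    (hU : Module.Injective Λ U) :
    ∀ f : U →ₗ[Λ] ((P 1 →ₗ[Λ] Λ) →ₗ[k] k),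
      ldmap k Λ (p 0) ∘ₗ f = 0 ↔ ∃ g : U →ₗ[Λ] ((P 2 →ₗ[Λ] Λ) →ₗ[k] k),
        ldmap k Λ (p 1) ∘ₗ g = f := by

  intro f
  constructor
  · intro hf
    letI : Module k U := Module.compHom U (algebraMap k Λ)
    haveI : IsScalarTower k Λ U := ⟨fun c a u => by
      rw [Algebra.smul_def, mul_smul]; rfl⟩
    haveI : SMulCommClass Λ k U := ⟨fun a c u => by
      show a • (algebraMap k Λ c • u) = algebraMap k Λ c • (a • u)
      rw [← mul_smul, ← mul_smul, Algebra.commutes]⟩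
    haveI := hPfin 0
    haveI := hPfin 1
    haveI := hPproj 0
    haveI := hPproj 1
    exact aux_main hU (p 0) (p 1) (hex 0) f hf
  · rintro ⟨g, rfl⟩
    have h0 : p 0 ∘ₗ p 1 = 0 := (hex 0).linearMap_comp_eq_zero
    ext u α
    show g u ((α ∘ₗ p 0) ∘ₗ p 1) = 0
    rw [LinearMap.comp_assoc, h0, LinearMap.comp_zero, map_zero]
end
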